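/- arXiv:2203.16431 — 2 statements merged into one kernel-verified Lean document; each statement's English description precedes it below -/
import Mathlib

section
/- Let L be a ternary lattice stable at 2, and write n = β·2^a with β odd and a≥0. If L is odd and L_2 is anisotropic, then α_2(n,L) = 3·2^{−(a+1)/2} if a is odd; 3·2^{−(a+2)/2} if a is even and β ≡ d_L (mod 4); 2^{−a/2} if a is even and β ≡ 3d_L (mod 8); and 0 if a is even and β ≡ 7d_L (mod 8). If L is odd and L_2 is isotropic, then α_2(n,L) = 2 − 3·2^{−(a+1)/2} if a is odd; 2 − 3·2^{−(a+2)/2} if a is even and β ≡ d_L (mod 4); 2 − 2^{−a/2} if a is even and β ≡ 3d_L (mod 8); and 2 if a is even and β ≡ 7d_L (mod 8). If L is even, then α_2(n,L) = 3 − 3·2^{−a/2} if a is even; 3 − 3·2^{−(a+1)/2} if a is odd and β ≡ d_L/2 (mod 4); 3 − 2^{−(a−1)/2} if a is odd and β ≡ 3d_L/2 (mod 8); and 3 if a is odd and β ≡ 7d_L/2 (mod 8). -/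
open scoped BigOperators Classical
open Matrix Filter

noncomputable section

/-! ## Binary quadratic forms, class numbers, and Hurwitz class numbers -/

/-- `(a,b,c)` represents the primitive positive-definite binary quadratic form
`a x² + b x y + c y²` of discriminant `d`. -/
def IsPrimPosDefBQF (d : ℤ) (f : ℤ × ℤ × ℤ) : Prop :=
  f.2.1 ^ 2 - 4 * f.1 * f.2.2 = d ∧ Int.gcd f.1 (Int.gcd f.2.1 f.2.2) = 1 ∧ 0 < f.1

/-- `SL₂(ℤ)`-equivalence of binary quadratic forms. -/
def BQFEquiv (f g : ℤ × ℤ × ℤ) : Prop :=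
  ∃ M : Matrix.SpecialLinearGroup (Fin 2) ℤ,
    g.1 = f.1 * M 0 0 ^ 2 + f.2.1 * M 0 0 * M 1 0 + f.2.2 * M 1 0 ^ 2 ∧
    g.2.1 = 2 * f.1 * M 0 0 * M 0 1 + f.2.1 * (M 0 0 * M 1 1 + M 0 1 * M 1 0) +
        2 * f.2.2 * M 1 0 * M 1 1 ∧
    g.2.2 = f.1 * M 0 1 ^ 2 + f.2.1 * M 0 1 * M 1 1 + f.2.2 * M 1 1 ^ 2

/-- The class number `h(d)`: the number of `SL₂(ℤ)`-classes of primitive positive-definite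
binary quadratic forms of discriminant `d`. -/
def classNum (d : ℤ) : ℕ :=
  Nat.card (Quot fun f g : {f : ℤ × ℤ × ℤ // IsPrimPosDefBQF d f} => BQFEquiv f.1 g.1)

/-- The number of automorphs `w_d`. -/
def wAut (d : ℤ) : ℕ := if d = -3 then 6 else if d = -4 then 4 else 2

def hurwitzNat (N : ℕ) : ℚ :=
  if 0 < N ∧ (N % 4 = 0 ∨ N % 4 = 3) then
    ∑ f ∈ N.divisors.filter fun f => f ^ 2 ∣ N,
      (classNum (-((N / f ^ 2 : ℕ) : ℤ)) : ℚ) / ((wAut (-((N / f ^ 2 : ℕ) : ℤ)) : ℚ) / 2)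
  else 0

/-- Hurwitz class number, with the convention `H(x) = 0` unless `x` is a positive integer
congruent to `0` or `3 (mod 4)`. -/
def hurwitz (x : ℚ) : ℚ := if x.den = 1 ∧ 0 ≤ x.num then hurwitzNat x.num.toNat else 0

/-! ## Kronecker symbol and fundamental discriminants -/

def kron2 (a : ℤ) : ℤ := if a % 2 = 0 then 0 else if a % 8 = 1 ∨ a % 8 = 7 then 1 else -1

/-- The Kronecker symbol `(a / n)` for `n ∈ ℕ`. -/
def kroneckerSym (a : ℤ) (n : ℕ) : ℤ :=
  kron2 a ^ padicValNat 2 n * jacobiSym a (n / 2 ^ padicValNat 2 n)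

/-- Fundamental discriminants. -/
def IsFundamentalDisc (d : ℤ) : Prop :=
  d % 4 = 1 ∧ Squarefree d ∨ d % 4 = 0 ∧ Squarefree (d / 4) ∧ (d / 4 % 4 = 2 ∨ d / 4 % 4 = 3)

/-! ## Ternary quadratic lattices via Gram matrices -/

abbrev TernMat := Matrix (Fin 3) (Fin 3) ℤ

/-- The quadratic form attached to a Gram matrix. -/
def quadVal {R : Type*} [CommRing R] {k : ℕ} (M : Matrix (Fin k) (Fin k) R) (x : Fin k → R) : R :=
  ∑ i, ∑ j, x i * M i j * x j

/-- `A` is the Gram matrix of a positive-definite integral ternary lattice. -/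
def IsLat (A : TernMat) : Prop := A.IsSymm ∧ ∀ x : Fin 3 → ℤ, x ≠ 0 → 0 < quadVal A x

/-- The number of representations of `n` by the lattice with Gram matrix `A`. -/
def rRep (n : ℤ) (A : TernMat) : ℕ := Nat.card {x : Fin 3 → ℤ // quadVal A x = n}

/-- Isometry of ternary lattices via their Gram matrices. -/
def LatIsom (A B : TernMat) : Prop := ∃ U : TernMat, IsUnit U.det ∧ Uᵀ * A * U = B

/-- The number of automorphs `o(L)`. -/
def numAut (A : TernMat) : ℕ := Nat.card {U : TernMat // IsUnit U.det ∧ Uᵀ * A * U = A}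

def padicMat (p : ℕ) [Fact p.Prime] {k : ℕ} (A : Matrix (Fin k) (Fin k) ℤ) :
    Matrix (Fin k) (Fin k) ℤ_[p] := A.map Int.cast

/-- Isometry of `ℤ_p`-lattices given by Gram matrices. -/
def PadicIsomP (p : ℕ) [Fact p.Prime] {k : ℕ} (M N : Matrix (Fin k) (Fin k) ℤ_[p]) : Prop :=
  ∃ U : Matrix (Fin k) (Fin k) ℤ_[p], IsUnit U.det ∧ Uᵀ * M * U = N

/-- `A ⊗ ℤ_p ≅ B ⊗ ℤ_p`. -/
def PadicLatIsom (p : ℕ) (hp : p.Prime) (A B : TernMat) : Prop :=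
  letI : Fact p.Prime := ⟨hp⟩
  PadicIsomP p (padicMat p A) (padicMat p B)

/-- `B` is (the Gram matrix of a lattice) in the genus of `A`. -/
def InGenus (A B : TernMat) : Prop :=
  IsLat B ∧ ∀ (p : ℕ) (hp : p.Prime), PadicLatIsom p hp A B

/-- The mass `w(L)` of the genus of `A`. -/
def massOf (A : TernMat) : ℝ :=
  ∑ᶠ c : Quot fun B C : {B : TernMat // InGenus A B} => LatIsom B.1 C.1,
    ((numAut (Quot.out c).1 : ℝ))⁻¹

/-- The Siegel–Weil average `r(n, gen(L))`. -/
def rGenus (n : ℤ) (A : TernMat) : ℝ :=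
  (massOf A)⁻¹ *
    ∑ᶠ c : Quot fun B C : {B : TernMat // InGenus A B} => LatIsom B.1 C.1,
      (rRep n (Quot.out c).1 : ℝ) / (numAut (Quot.out c).1 : ℝ)

/-! ## Local invariants -/

/-- `L_p` is isotropic. -/
def IsotropicP (p : ℕ) [Fact p.Prime] (A : TernMat) : Prop :=
  ∃ x : Fin 3 → ℤ_[p], x ≠ 0 ∧ quadVal (padicMat p A) x = 0

/-- The modified Hasse symbol `S_p*(L)`: `1` if `L_p` is isotropic, `-1` if anisotropic. -/
def SpStar (p : ℕ) (A : TernMat) : ℤ :=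
  if h : p.Prime then
    letI : Fact p.Prime := ⟨h⟩
    if IsotropicP p A then 1 else -1
  else 1

/-- The lattice is even: all represented numbers are even. -/
def IsEvenLat (A : TernMat) : Prop := ∀ x : Fin 3 → ℤ, 2 ∣ quadVal A x

/-- The lattice is primitive: its scale ideal is `ℤ`. -/
def IsPrimitiveLat (A : TernMat) : Prop :=
  Finset.univ.gcd (fun ij : Fin 3 × Fin 3 => (A ij.1 ij.2).natAbs) = 1

/-- Stability at a prime `p`. -/
def StableAt (A : TernMat) (p : ℕ) : Prop :=
  padicValInt p A.det ≤ 1 ∧ (p = 2 → (padicValInt 2 A.det = 1 ↔ IsEvenLat A))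

/-- A stable (primitive) ternary lattice. -/
def IsStable (A : TernMat) : Prop := IsPrimitiveLat A ∧ ∀ p : ℕ, p.Prime → StableAt A p

def RepresentedAt (p : ℕ) (hp : p.Prime) (n : ℤ) (A : TernMat) : Prop :=
  letI : Fact p.Prime := ⟨hp⟩
  ∃ x : Fin 3 → ℤ_[p], quadVal (padicMat p A) x = (n : ℤ_[p])

/-- `n` is represented by `L_p` for every prime `p`. -/
def LocallyRepresented (n : ℤ) (A : TernMat) : Prop :=
  ∀ (p : ℕ) (hp : p.Prime), RepresentedAt p hp n A

/-! ## Siegel local densities -/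

/-- The Siegel local density `α_p(n, L)` (here `s = 1`, `t = 3`). -/
def localDensity (p : ℕ) (hp : p.Prime) (n : ℤ) (A : TernMat) : ℝ :=
  limUnder atTop fun r : ℕ =>
    (Nat.card {X : Fin 3 → ZMod (p ^ r) //
        (∑ i, ∑ j, X i * (A i j : ZMod (p ^ r)) * X j) = (n : ZMod (p ^ r))} : ℝ) /
      (p : ℝ) ^ (2 * r)

def localDensityN (p : ℕ) (n : ℤ) (A : TernMat) : ℝ :=
  if h : p.Prime then localDensity p h n A else 0

/-- The value `L(1, χ_a)` of the Dirichlet series attached to the Kronecker symbol `(a/·)`. -/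
def LOne (a : ℤ) : ℝ :=
  limUnder atTop fun N : ℕ =>
    ∑ k ∈ Finset.range N, (kroneckerSym a (k + 1) : ℝ) / (k + 1)

/-! ## Watson transformations (Gram matrix form) -/

/-- The underlying set of `Λ_m(L)` in the coordinates of `L`. -/
def watsonSetG (m : ℕ) (A : TernMat) : Set (Fin 3 → ℤ) :=
  {x | ∀ y : Fin 3 → ℤ, (m : ℤ) ∣ (quadVal A (x + y) - quadVal A y)}

/-- `B` is a Gram matrix for the sublattice `Λ_m(L)` of the lattice `L` with Gram matrix `A`. -/
def IsWatsonGram (m : ℕ) (A B : TernMat) : Prop :=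
  ∃ T : TernMat, Set.range T.mulVec = watsonSetG m A ∧ B = Tᵀ * A * T

/-- `B` is a Gram matrix of the Watson transform `λ_m(L)`: the primitive rescaling of `Λ_m(L)`. -/
def IsLambdaGram (m : ℕ) (A B : TernMat) : Prop :=
  IsPrimitiveLat B ∧
    ∃ (B₀ : TernMat) (c : ℚ), 0 < c ∧ IsWatsonGram m A B₀ ∧
      B.map ((↑) : ℤ → ℚ) = c • B₀.map ((↑) : ℤ → ℚ)

/-- The `3×3` Gram matrix of the orthogonal sum `M ⊥ U`. -/
def blockMat3 {p : ℕ} [Fact p.Prime] (k : ℕ) (hk : k ≤ 3)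
    (M : Matrix (Fin k) (Fin k) ℤ_[p]) (U : Matrix (Fin (3 - k)) (Fin (3 - k)) ℤ_[p]) :
    Matrix (Fin 3) (Fin 3) ℤ_[p] :=
  Matrix.reindex (finSumFinEquiv.trans (finCongr (by omega)))
    (finSumFinEquiv.trans (finCongr (by omega))) (Matrix.fromBlocks M 0 0 U)

end
set_option linter.unusedSimpArgs false

/-! ## Triple sums over residues -/

/-- Sum of `f` over the box `[0,M)³`. -/
def tripSum (M : ℕ) (f : ℤ → ℤ → ℤ → ℕ) : ℕ :=
  ∑ i ∈ Finset.range M, ∑ j ∈ Finset.range M, ∑ k ∈ Finset.range M, f i j k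

/-- `f` is periodic with period `M` in each variable. -/
def Per3 (M : ℕ) (f : ℤ → ℤ → ℤ → ℕ) : Prop :=
  (∀ x y z, f (x + M) y z = f x y z) ∧ (∀ x y z, f x (y + M) z = f x y z) ∧
    (∀ x y z, f x y (z + M) = f x y z)

lemma sum_shift (M : ℕ) (g : ℤ → ℕ) (h : ∀ x, g (x + M) = g x) (u : ℤ) :
    ∑ i ∈ Finset.range M, g (i + u) = ∑ i ∈ Finset.range M, g i := by
  have step : ∀ u : ℤ, ∑ i ∈ Finset.range M, g (i + (u + 1)) = ∑ i ∈ Finset.range M, g (i + u) := by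
    intro u
    have h1 := Finset.sum_range_succ (fun i : ℕ => g (i + u)) M
    have h2 := Finset.sum_range_succ' (fun i : ℕ => g (i + u)) M
    have h3 : g ((M : ℤ) + u) = g (((0 : ℕ) : ℤ) + u) := by
      rw [add_comm, h]; simp
    have h4 : ∑ i ∈ Finset.range M, g (((i + 1 : ℕ) : ℤ) + u)
        = ∑ i ∈ Finset.range M, g (i + (u + 1)) := by
      refine Finset.sum_congr rfl fun i _ => ?_
      congr 1; push_cast; ring
    omega
  induction u using Int.induction_on with
  | zero => simp
  | succ k ih => rw [step, ih]
  | pred k ih => rw [← ih, ← step]; simp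

lemma sum_two (M : ℕ) (g : ℤ → ℕ) (h : ∀ x, g (x + M) = g x) :
    ∑ i ∈ Finset.range (2 * M), g i = 2 * ∑ i ∈ Finset.range M, g i := by
  rw [two_mul, Finset.sum_range_add, two_mul]
  congr 1
  refine Finset.sum_congr rfl fun i _ => ?_
  rw [← h i]; congr 1; push_cast; ring

lemma sum_even (M : ℕ) (g : ℤ → ℕ) (h : ∀ x, ¬ 2 ∣ x → g x = 0) :
    ∑ i ∈ Finset.range (2 * M), g i = ∑ i ∈ Finset.range M, g (2 * i) := by
  induction M with
  | zero => simp
  | succ M ih =>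
    rw [show 2 * (M + 1) = 2 * M + 1 + 1 by ring, Finset.sum_range_succ, Finset.sum_range_succ, ih,
      Finset.sum_range_succ, h (((2 * M + 1 : ℕ)) : ℤ) (by omega)]
    push_cast; simp

lemma tripSum_congr (M : ℕ) {f g : ℤ → ℤ → ℤ → ℕ} (h : ∀ x y z, f x y z = g x y z) :
    tripSum M f = tripSum M g := by
  unfold tripSum; simp only [h]

lemma tripSum_swap12 (M : ℕ) (f : ℤ → ℤ → ℤ → ℕ) :
    tripSum M f = tripSum M (fun x y z => f y x z) := by
  unfold tripSum; rw [Finset.sum_comm]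

lemma tripSum_swap23 (M : ℕ) (f : ℤ → ℤ → ℤ → ℕ) :
    tripSum M f = tripSum M (fun x y z => f x z y) := by
  unfold tripSum
  refine Finset.sum_congr rfl fun i _ => ?_
  rw [Finset.sum_comm]

lemma tripSum_shear3 (M : ℕ) (f : ℤ → ℤ → ℤ → ℕ) (h : Per3 M f) (u : ℤ → ℤ → ℤ) :
    tripSum M (fun x y z => f x y (z + u x y)) = tripSum M f := by
  unfold tripSum
  refine Finset.sum_congr rfl fun i _ => Finset.sum_congr rfl fun j _ => ?_
  exact sum_shift M (fun z => f i j z) (fun z => h.2.2 _ _ _) _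

lemma tripSum_shear2 (M : ℕ) (f : ℤ → ℤ → ℤ → ℕ) (h : Per3 M f) (u : ℤ → ℤ → ℤ) :
    tripSum M (fun x y z => f x (y + u x z) z) = tripSum M f := by
  rw [tripSum_swap23 M f, tripSum_swap23]
  exact tripSum_shear3 M (fun x y z => f x z y) ⟨fun _ _ _ => h.1 _ _ _, fun _ _ _ => h.2.2 _ _ _,
    fun _ _ _ => h.2.1 _ _ _⟩ u

lemma tripSum_shear1 (M : ℕ) (f : ℤ → ℤ → ℤ → ℕ) (h : Per3 M f) (u : ℤ → ℤ → ℤ) :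
    tripSum M (fun x y z => f (x + u y z) y z) = tripSum M f := by
  rw [tripSum_swap12 M f, tripSum_swap12]
  exact tripSum_shear2 M (fun x y z => f y x z) ⟨fun _ _ _ => h.2.1 _ _ _, fun _ _ _ => h.1 _ _ _,
    fun _ _ _ => h.2.2 _ _ _⟩ u

lemma tripSum_shift (M : ℕ) (f : ℤ → ℤ → ℤ → ℕ) (h : Per3 M f) (u v w : ℤ) :
    tripSum M (fun x y z => f (x + u) (y + v) (z + w)) = tripSum M f := by
  have p1 : Per3 M (fun x y z => f x y (z + w)) :=
    ⟨fun _ _ _ => h.1 _ _ _, fun _ _ _ => h.2.1 _ _ _,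
      fun x y z => by show f x y (z + M + w) = _; rw [add_right_comm, h.2.2]⟩
  have p2 : Per3 M (fun x y z => f x (y + v) (z + w)) :=
    ⟨fun _ _ _ => h.1 _ _ _,
      fun x y z => by show f x (y + M + v) (z + w) = _; rw [add_right_comm, h.2.1],
      fun _ _ _ => p1.2.2 _ _ _⟩
  rw [tripSum_shear1 M (fun x y z => f x (y + v) (z + w)) p2 (fun _ _ => u),
    tripSum_shear2 M (fun x y z => f x y (z + w)) p1 (fun _ _ => v), 
    tripSum_shear3 M f h (fun _ _ => w)]

lemma tripSum_two (M : ℕ) (f : ℤ → ℤ → ℤ → ℕ) (h : Per3 M f) :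
    tripSum (2 * M) f = 8 * tripSum M f := by
  unfold tripSum
  have h3 : ∀ i j : ℤ, ∑ k ∈ Finset.range (2 * M), f i j k = 2 * ∑ k ∈ Finset.range M, f i j k :=
    fun i j => sum_two M (fun z => f i j z) (fun z => h.2.2 _ _ _)
  have h2 : ∀ i : ℤ, ∑ j ∈ Finset.range (2 * M), ∑ k ∈ Finset.range (2 * M), f i j k
      = 4 * ∑ j ∈ Finset.range M, ∑ k ∈ Finset.range M, f i j k := by
    intro i
    simp only [h3]
    rw [sum_two M (fun y => 2 * ∑ k ∈ Finset.range M, f i y k) (fun y => by simp only [h.2.1]),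
      ← Finset.mul_sum]
    ring
  simp only [h2]
  rw [sum_two M (fun x => 4 * ∑ j ∈ Finset.range M, ∑ k ∈ Finset.range M, f x j k)
    (fun y => by simp only [h.1]), ← Finset.mul_sum]
  ring

lemma tripSum_even (M : ℕ) (f : ℤ → ℤ → ℤ → ℕ)
    (h : ∀ x y z, ¬ (2 ∣ x ∧ 2 ∣ y ∧ 2 ∣ z) → f x y z = 0) :
    tripSum (2 * M) f = tripSum M (fun x y z => f (2 * x) (2 * y) (2 * z)) := by
  unfold tripSum
  have h3 : ∀ i j : ℤ, ∑ k ∈ Finset.range (2 * M), f i j k = ∑ k ∈ Finset.range M, f i j (2 * k) :=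
    fun i j => sum_even M (fun z => f i j z) (fun z hz => h _ _ _ (by tauto))
  have h2 : ∀ i : ℤ, ∑ j ∈ Finset.range (2 * M), ∑ k ∈ Finset.range (2 * M), f i j k
      = ∑ j ∈ Finset.range M, ∑ k ∈ Finset.range M, f i (2 * j) (2 * k) := by
    intro i
    simp only [h3]
    exact sum_even M (fun y => ∑ k ∈ Finset.range M, f i y (2 * k))
      (fun y hy => Finset.sum_eq_zero fun k _ => h _ _ _ (by tauto))
  simp only [h2]
  exact sum_even M (fun x => ∑ j ∈ Finset.range M, ∑ k ∈ Finset.range M, f x (2 * j) (2 * k))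
      (fun y hy => Finset.sum_eq_zero fun k _ => Finset.sum_eq_zero fun k _ => h _ _ _ (by tauto))

lemma tripSum_add (M : ℕ) (f g : ℤ → ℤ → ℤ → ℕ) :
    tripSum M (fun x y z => f x y z + g x y z) = tripSum M f + tripSum M g := by
  unfold tripSum; simp only [Finset.sum_add_distrib]

/-! ## Integral ternary forms -/

open scoped Classical in
/-- Indicator of a proposition. -/
noncomputable def ind (P : Prop) : ℕ := if P then 1 else 0

lemma ind_pos {P : Prop} (h : P) : ind P = 1 := if_pos h

lemma ind_neg {P : Prop} (h : ¬ P) : ind P = 0 := if_neg h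

lemma ind_true : ind True = 1 := ind_pos trivial

lemma ind_false : ind False = 0 := ind_neg id

lemma ind_congr {P Q : Prop} (h : P ↔ Q) : ind P = ind Q := by rw [propext h]


/-- The ternary quadratic form with coefficients `a,b,c,d,e,f`. -/
def tqf (a b c d e f x y z : ℤ) : ℤ :=
  a * x ^ 2 + b * y ^ 2 + c * z ^ 2 + d * y * z + e * x * z + f * x * y

/-- All three coordinates even. -/
def AllEven (x y z : ℤ) : Prop := 2 ∣ x ∧ 2 ∣ y ∧ 2 ∣ z

/-- Number of solutions of `q = n` modulo `M`. -/
noncomputable def solCount (q : ℤ → ℤ → ℤ → ℤ) (M : ℕ) (n : ℤ) : ℕ :=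
  tripSum M (fun x y z => ind ((M : ℤ) ∣ q x y z - n))

/-- Number of primitive solutions of `q = n` modulo `M`. -/
noncomputable def primCount (q : ℤ → ℤ → ℤ → ℤ) (M : ℕ) (n : ℤ) : ℕ :=
  tripSum M (fun x y z => ind (¬ AllEven x y z ∧ (M : ℤ) ∣ q x y z - n))

/-- Nondegeneracy: the gradient of the form at a primitive vector is nonzero modulo `4`. -/
def GradCond (a b c d e f : ℤ) : Prop :=
  ∀ x y z : ℤ, 4 ∣ 2 * a * x + f * y + e * z → 4 ∣ f * x + 2 * b * y + d * z →
    4 ∣ e * x + d * y + 2 * c * z → AllEven x y z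

lemma allEven_add (x y z u v w : ℤ) (hu : 2 ∣ u) (hv : 2 ∣ v) (hw : 2 ∣ w) :
    AllEven (x + u) (y + v) (z + w) ↔ AllEven x y z := by
  unfold AllEven; omega

lemma dvd_iff_of_dvd_sub {M s t : ℤ} (h : M ∣ s - t) : M ∣ s ↔ M ∣ t := by
  constructor
  · intro h1; have := dvd_sub h1 h; simpa using this
  · intro h1; have := dvd_add h1 h; simpa using this

lemma tqf_per (a b c d e f : ℤ) (M : ℤ) (n x y z u v w : ℤ) :
    M ∣ tqf a b c d e f (x + M * u) (y + M * v) (z + M * w) - n ↔ M ∣ tqf a b c d e f x y z - n := by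
  apply dvd_iff_of_dvd_sub
  unfold tqf
  exact ⟨a * (2 * x * u + M * u ^ 2) + b * (2 * y * v + M * v ^ 2) + c * (2 * z * w + M * w ^ 2)
    + d * (y * w + v * z + M * v * w) + e * (x * w + u * z + M * u * w)
    + f * (x * v + u * y + M * u * v), by ring⟩

lemma per3_of (f : ℤ → ℤ → ℤ → ℕ) (M : ℕ)
    (h : ∀ x y z u v w, f (x + M * u) (y + M * v) (z + M * w) = f x y z) : Per3 M f := by
  refine ⟨fun x y z => ?_, fun x y z => ?_, fun x y z => ?_⟩
  · simpa using h x y z 1 0 0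
  · simpa using h x y z 0 1 0
  · simpa using h x y z 0 0 1

lemma sol_per (a b c d e f : ℤ) (M : ℕ) (n : ℤ) :
    Per3 M (fun x y z => ind ((M : ℤ) ∣ tqf a b c d e f x y z - n)) := by
  refine per3_of _ _ fun x y z u v w => ind_congr ?_
  exact tqf_per ..

lemma prim_per (a b c d e f : ℤ) (M : ℕ) (hM : 2 ∣ M) (n : ℤ) :
    Per3 M (fun x y z => ind (¬ AllEven x y z ∧ (M : ℤ) ∣ tqf a b c d e f x y z - n)) := by
  have h2 : (2 : ℤ) ∣ M := by exact_mod_cast hM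
  refine per3_of _ _ fun x y z u v w => ind_congr ?_
  rw [tqf_per, allEven_add _ _ _ _ _ _ (h2.mul_right _) (h2.mul_right _) (h2.mul_right _)]

/-- Shift step: a class `K` of vectors, stable under a shift which changes the value by
`h` modulo `2h`. -/
lemma class_shift (q : ℤ → ℤ → ℤ → ℤ) (M : ℕ) (n h : ℤ) (K : ℤ → ℤ → ℤ → Prop) (u v w : ℤ)
    (hMh : (M : ℤ) = 2 * h) (hu : 4 ∣ u) (hv : 4 ∣ v) (hw : 4 ∣ w)
    (hper : ∀ x y z u v w n, (M : ℤ) ∣ q (x + M * u) (y + M * v) (z + M * w) - n ↔ (M : ℤ) ∣ q x y z - n)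
    (h4 : (4 : ℤ) ∣ M)
    (hK : ∀ x y z u v w, 4 ∣ u → 4 ∣ v → 4 ∣ w → (K (x + u) (y + v) (z + w) ↔ K x y z))
    (hq : ∀ x y z, K x y z → (M : ℤ) ∣ q (x + u) (y + v) (z + w) - q x y z - h) :
    tripSum M (fun x y z => ind (K x y z ∧ ¬ AllEven x y z ∧ (M : ℤ) ∣ q x y z - n)) =
    tripSum M (fun x y z => ind (K x y z ∧ ¬ AllEven x y z ∧ (M : ℤ) ∣ q x y z - (n + h))) := by
  have h2 : (2 : ℤ) ∣ M := ⟨h, hMh⟩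
  rw [← tripSum_shift M _ _ u v w]
  · refine tripSum_congr _ fun x y z => ind_congr ?_
    rw [hK _ _ _ _ _ _ hu hv hw, allEven_add _ _ _ _ _ _ (by omega) (by omega) (by omega)]
    refine and_congr_right fun hk => and_congr_right fun _ => ?_
    apply dvd_iff_of_dvd_sub
    have := hq x y z hk
    have e1 : q (x + u) (y + v) (z + w) - n - (q x y z - (n + h)) =
      (q (x + u) (y + v) (z + w) - q x y z - h) + M := by rw [hMh]; ring
    rw [e1]
    exact dvd_add this dvd_rfl
  · refine per3_of _ _ fun x y z u v w => ind_congr ?_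
    rw [hper, allEven_add _ _ _ _ _ _ (h2.mul_right _) (h2.mul_right _) (h2.mul_right _),
      hK _ _ _ _ _ _ (h4.mul_right _) (h4.mul_right _) (h4.mul_right _)]

lemma hensel_step (a b c d e f : ℤ) (hG : GradCond a b c d e f) (k : ℕ) (hk : 4 ∣ k) (n : ℤ) :
    primCount (tqf a b c d e f) (4 * k) n = primCount (tqf a b c d e f) (4 * k) (n + 2 * k) := by
  obtain ⟨k', rfl⟩ := hk
  set g1 : ℤ → ℤ → ℤ → ℤ := fun x y z => 2 * a * x + f * y + e * z with hg1
  set g2 : ℤ → ℤ → ℤ → ℤ := fun x y z => f * x + 2 * b * y + d * z with hg2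
  set g3 : ℤ → ℤ → ℤ → ℤ := fun x y z => e * x + d * y + 2 * c * z with hg3
  have hs1 : ∀ x y z u v w, 4 ∣ u → 4 ∣ v → 4 ∣ w → ∃ t, g1 (x + u) (y + v) (z + w) = g1 x y z + 4 * t := by
    rintro x y z _ _ _ ⟨u, rfl⟩ ⟨v, rfl⟩ ⟨w, rfl⟩
    exact ⟨2 * a * u + f * v + e * w, by simp only [hg1]; ring⟩
  have hs2 : ∀ x y z u v w, 4 ∣ u → 4 ∣ v → 4 ∣ w → ∃ t, g2 (x + u) (y + v) (z + w) = g2 x y z + 4 * t := by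
    rintro x y z _ _ _ ⟨u, rfl⟩ ⟨v, rfl⟩ ⟨w, rfl⟩
    exact ⟨f * u + 2 * b * v + d * w, by simp only [hg2]; ring⟩
  have hs3 : ∀ x y z u v w, 4 ∣ u → 4 ∣ v → 4 ∣ w → ∃ t, g3 (x + u) (y + v) (z + w) = g3 x y z + 4 * t := by
    rintro x y z _ _ _ ⟨u, rfl⟩ ⟨v, rfl⟩ ⟨w, rfl⟩
    exact ⟨e * u + d * v + 2 * c * w, by simp only [hg3]; ring⟩
  -- a class given by a condition on the gradient modulo 4
  have key : ∀ (C : ℤ → ℤ → ℤ → Prop) (u v w : ℤ), 4 ∣ u → 4 ∣ v → 4 ∣ w →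
      (∀ i j l i' j' l', (C (i + 4 * i') (j + 4 * j') (l + 4 * l') ↔ C i j l)) →
      (∀ x y z, C (g1 x y z) (g2 x y z) (g3 x y z) →
        ((4 * (4 * k') : ℕ) : ℤ) ∣ tqf a b c d e f (x + u) (y + v) (z + w) - tqf a b c d e f x y z
          - 2 * ((4 * k' : ℕ) : ℤ)) →
      tripSum (4 * (4 * k')) (fun x y z => ind (C (g1 x y z) (g2 x y z) (g3 x y z) ∧ ¬ AllEven x y z ∧
        ((4 * (4 * k') : ℕ) : ℤ) ∣ tqf a b c d e f x y z - n)) =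
      tripSum (4 * (4 * k')) (fun x y z => ind (C (g1 x y z) (g2 x y z) (g3 x y z) ∧ ¬ AllEven x y z ∧
        ((4 * (4 * k') : ℕ) : ℤ) ∣ tqf a b c d e f x y z - (n + 2 * ((4 * k' : ℕ) : ℤ)))) := by
    intro C u v w hu hv hw hC hq
    refine class_shift (tqf a b c d e f) _ n _ (fun x y z => C (g1 x y z) (g2 x y z) (g3 x y z))
      u v w ?_ hu hv hw ?_ ?_ ?_ hq
    · push_cast; ring
    · intro x y z u v w n; exact tqf_per ..
    · exact ⟨4 * k', by push_cast; ring⟩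
    · intro x y z u v w hu hv hw
      obtain ⟨t1, h1⟩ := hs1 x y z u v w hu hv hw
      obtain ⟨t2, h2⟩ := hs2 x y z u v w hu hv hw
      obtain ⟨t3, h3⟩ := hs3 x y z u v w hu hv hw
      simp only [h1, h2, h3, hC]
  have split : ∀ m : ℤ, primCount (tqf a b c d e f) (4 * (4 * k')) m =
      tripSum (4 * (4 * k')) (fun x y z => ind ((¬ 2 ∣ g1 x y z) ∧ ¬ AllEven x y z ∧
        ((4 * (4 * k') : ℕ) : ℤ) ∣ tqf a b c d e f x y z - m)) +
      tripSum (4 * (4 * k')) (fun x y z => ind ((2 ∣ g1 x y z ∧ ¬ 2 ∣ g2 x y z) ∧ ¬ AllEven x y z ∧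
        ((4 * (4 * k') : ℕ) : ℤ) ∣ tqf a b c d e f x y z - m)) +
      tripSum (4 * (4 * k')) (fun x y z => ind ((2 ∣ g1 x y z ∧ 2 ∣ g2 x y z ∧ ¬ 2 ∣ g3 x y z) ∧
        ¬ AllEven x y z ∧
        ((4 * (4 * k') : ℕ) : ℤ) ∣ tqf a b c d e f x y z - m)) +
      tripSum (4 * (4 * k')) (fun x y z => ind ((2 ∣ g1 x y z ∧ 2 ∣ g2 x y z ∧ 2 ∣ g3 x y z ∧
        ¬ 4 ∣ g1 x y z) ∧ ¬ AllEven x y z ∧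
        ((4 * (4 * k') : ℕ) : ℤ) ∣ tqf a b c d e f x y z - m)) +
      tripSum (4 * (4 * k')) (fun x y z => ind ((2 ∣ g1 x y z ∧ 2 ∣ g2 x y z ∧ 2 ∣ g3 x y z ∧
        4 ∣ g1 x y z ∧ ¬ 4 ∣ g2 x y z) ∧ ¬ AllEven x y z ∧
        ((4 * (4 * k') : ℕ) : ℤ) ∣ tqf a b c d e f x y z - m)) +
      tripSum (4 * (4 * k')) (fun x y z => ind ((2 ∣ g1 x y z ∧ 2 ∣ g2 x y z ∧ 2 ∣ g3 x y z ∧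
        4 ∣ g1 x y z ∧ 4 ∣ g2 x y z ∧ ¬ 4 ∣ g3 x y z) ∧ ¬ AllEven x y z ∧
        ((4 * (4 * k') : ℕ) : ℤ) ∣ tqf a b c d e f x y z - m)) := by
    intro m
    rw [← tripSum_add, ← tripSum_add, ← tripSum_add, ← tripSum_add, ← tripSum_add]
    refine tripSum_congr _ fun x y z => ?_
    have hg := hG x y z
    change 4 ∣ g1 x y z → 4 ∣ g2 x y z → 4 ∣ g3 x y z → AllEven x y z at hg
    by_cases hA : AllEven x y z
    · simp only [hA, not_true_eq_false, not_false_eq_true, and_true, true_and, and_false,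
        false_and, ind_true, ind_false, add_zero, zero_add]
    by_cases hD : ((4 * (4 * k') : ℕ) : ℤ) ∣ tqf a b c d e f x y z - m
    swap
    · simp only [hD, not_true_eq_false, not_false_eq_true, and_true, true_and, and_false,
        false_and, ind_true, ind_false, add_zero, zero_add]
    by_cases c1 : 2 ∣ g1 x y z
    swap
    · simp only [hA, hD, c1, not_true_eq_false, not_false_eq_true, and_true, true_and, and_false,
        false_and, ind_true, ind_false, add_zero, zero_add]
    by_cases c2 : 2 ∣ g2 x y z
    swap
    · simp only [hA, hD, c1, c2, not_true_eq_false, not_false_eq_true, and_true, true_and, and_false,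
        false_and, ind_true, ind_false, add_zero, zero_add]
    by_cases c3 : 2 ∣ g3 x y z
    swap
    · simp only [hA, hD, c1, c2, c3, not_true_eq_false, not_false_eq_true, and_true, true_and, and_false,
        false_and, ind_true, ind_false, add_zero, zero_add]
    by_cases c4 : 4 ∣ g1 x y z
    swap
    · simp only [hA, hD, c1, c2, c3, c4, not_true_eq_false, not_false_eq_true, and_true, true_and, and_false,
        false_and, ind_true, ind_false, add_zero, zero_add]
    by_cases c5 : 4 ∣ g2 x y z
    swap
    · simp only [hA, hD, c1, c2, c3, c4, c5, not_true_eq_false, not_false_eq_true, and_true, true_and, and_false,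
        false_and, ind_true, ind_false, add_zero, zero_add]
    have c6 : ¬ 4 ∣ g3 x y z := fun h => hA (hg c4 c5 h)
    simp only [hA, hD, c1, c2, c3, c4, c5, c6, not_true_eq_false, not_false_eq_true, and_true, true_and, and_false,
        false_and, ind_true, ind_false, add_zero, zero_add]
  rw [split, split]
  clear split
  refine congrArg₂ (· + ·) (congrArg₂ (· + ·) (congrArg₂ (· + ·) (congrArg₂ (· + ·)
    (congrArg₂ (· + ·) ?_ ?_) ?_) ?_) ?_) ?_
  · refine key (fun i j l => ¬ 2 ∣ i) (8 * k') 0 0 ⟨2 * k', by ring⟩ (dvd_zero _) (dvd_zero _) ?_ ?_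
    · intros; omega
    · intro x y z h
      obtain ⟨s, hs⟩ : ∃ s, g1 x y z = 2 * s + 1 := ⟨g1 x y z / 2, by omega⟩
      refine ⟨s + 4 * a * k', ?_⟩
      simp only [hg1] at hs
      push_cast; unfold tqf
      linear_combination (8 * (k' : ℤ)) * hs
  · refine key (fun i j l => 2 ∣ i ∧ ¬ 2 ∣ j) 0 (8 * k') 0 (dvd_zero _) ⟨2 * k', by ring⟩ (dvd_zero _) ?_ ?_
    · intros; omega
    · intro x y z h
      obtain ⟨s, hs⟩ : ∃ s, g2 x y z = 2 * s + 1 := ⟨g2 x y z / 2, by omega⟩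
      refine ⟨s + 4 * b * k', ?_⟩
      simp only [hg2] at hs
      push_cast; unfold tqf
      linear_combination (8 * (k' : ℤ)) * hs
  · refine key (fun i j l => 2 ∣ i ∧ 2 ∣ j ∧ ¬ 2 ∣ l) 0 0 (8 * k') (dvd_zero _) (dvd_zero _) ⟨2 * k', by ring⟩ ?_ ?_
    · intros; omega
    · intro x y z h
      obtain ⟨s, hs⟩ : ∃ s, g3 x y z = 2 * s + 1 := ⟨g3 x y z / 2, by omega⟩
      refine ⟨s + 4 * c * k', ?_⟩
      simp only [hg3] at hs
      push_cast; unfold tqf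
      linear_combination (8 * (k' : ℤ)) * hs
  · refine key (fun i j l => 2 ∣ i ∧ 2 ∣ j ∧ 2 ∣ l ∧ ¬ 4 ∣ i) (4 * k') 0 0 ⟨k', by ring⟩ (dvd_zero _) (dvd_zero _) ?_ ?_
    · intros; omega
    · intro x y z h
      obtain ⟨s, hs⟩ : ∃ s, g1 x y z = 4 * s + 2 := ⟨g1 x y z / 4, by omega⟩
      refine ⟨s + a * k', ?_⟩
      simp only [hg1] at hs
      push_cast; unfold tqf
      linear_combination (4 * (k' : ℤ)) * hs
  · refine key (fun i j l => 2 ∣ i ∧ 2 ∣ j ∧ 2 ∣ l ∧ 4 ∣ i ∧ ¬ 4 ∣ j) 0 (4 * k') 0 (dvd_zero _) ⟨k', by ring⟩ (dvd_zero _) ?_ ?_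
    · intros; omega
    · intro x y z h
      obtain ⟨s, hs⟩ : ∃ s, g2 x y z = 4 * s + 2 := ⟨g2 x y z / 4, by omega⟩
      refine ⟨s + b * k', ?_⟩
      simp only [hg2] at hs
      push_cast; unfold tqf
      linear_combination (4 * (k' : ℤ)) * hs
  · refine key (fun i j l => 2 ∣ i ∧ 2 ∣ j ∧ 2 ∣ l ∧ 4 ∣ i ∧ 4 ∣ j ∧ ¬ 4 ∣ l) 0 0 (4 * k') (dvd_zero _) (dvd_zero _) ⟨k', by ring⟩ ?_ ?_
    · intros; omega
    · intro x y z h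
      obtain ⟨s, hs⟩ : ∃ s, g3 x y z = 4 * s + 2 := ⟨g3 x y z / 4, by omega⟩
      refine ⟨s + c * k', ?_⟩
      simp only [hg3] at hs
      push_cast; unfold tqf
      linear_combination (4 * (k' : ℤ)) * hs

lemma primCount_congr (q : ℤ → ℤ → ℤ → ℤ) (M : ℕ) (n m : ℤ) (h : (M : ℤ) ∣ n - m) :
    primCount q M n = primCount q M m := by
  refine tripSum_congr _ fun x y z => ind_congr ?_
  have : (M : ℤ) ∣ q x y z - n ↔ (M : ℤ) ∣ q x y z - m := by
    apply dvd_iff_of_dvd_sub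
    have : q x y z - n - (q x y z - m) = -(n - m) := by ring
    rw [this]; exact (dvd_neg).2 h
  rw [this]

lemma hensel_double (a b c d e f : ℤ) (hG : GradCond a b c d e f) (k : ℕ) (hk0 : 0 < k)
    (hk : 4 ∣ k) (n : ℤ) :
    primCount (tqf a b c d e f) (4 * k) n = 4 * primCount (tqf a b c d e f) (2 * k) n := by
  have h1 := hensel_step a b c d e f hG k hk n
  have h2 := tripSum_two (2 * k) _ (prim_per a b c d e f (2 * k) ⟨k, rfl⟩ n)
  have h3 : tripSum (2 * (2 * k)) (fun x y z => ind (¬ AllEven x y z ∧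
        ((2 * k : ℕ) : ℤ) ∣ tqf a b c d e f x y z - n)) =
      primCount (tqf a b c d e f) (4 * k) n + primCount (tqf a b c d e f) (4 * k) (n + 2 * k) := by
    unfold primCount
    rw [← tripSum_add, show 2 * (2 * k) = 4 * k by ring]
    refine tripSum_congr _ fun x y z => ?_
    by_cases hA : AllEven x y z
    · simp only [hA, not_true_eq_false, not_false_eq_true, and_true, true_and, and_false,
        false_and, ind_true, ind_false, add_zero, zero_add]
    simp only [hA, not_false_eq_true, true_and]
    set t := tqf a b c d e f x y z - n with ht
    rw [show tqf a b c d e f x y z - (n + 2 * k) = t - 2 * k by rw [ht]; ring]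
    push_cast
    by_cases h : (2 * k : ℤ) ∣ t
    · obtain ⟨s, hs⟩ := h
      rw [hs]
      have e1 : (4 * k : ℤ) ∣ 2 * k * s ↔ 2 ∣ s := by
        rw [show (4 * k : ℤ) = 2 * k * 2 by ring]
        exact mul_dvd_mul_iff_left (by positivity)
      have e2 : (4 * k : ℤ) ∣ 2 * k * s - 2 * k ↔ 2 ∣ s - 1 := by
        rw [show (4 * k : ℤ) = 2 * k * 2 by ring, show (2 * k * s - 2 * k : ℤ) = 2 * k * (s - 1) by ring]
        exact mul_dvd_mul_iff_left (by positivity)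
      simp only [e1, e2, dvd_mul_right, ind_true]
      by_cases h2 : 2 ∣ s
      · rw [ind_pos h2, ind_neg (by omega)]
      · rw [ind_neg h2, ind_pos (by omega)]
    · have e1 : ¬ (4 * k : ℤ) ∣ t := fun h' => h (dvd_trans ⟨2, by ring⟩ h')
      have e2 : ¬ (4 * k : ℤ) ∣ t - 2 * k := fun h' => h (by
        have := dvd_add (dvd_trans (⟨2, by ring⟩ : (2 * k : ℤ) ∣ 4 * k) h') (dvd_refl (2 * k : ℤ))
        simpa using this)
      rw [ind_neg h, ind_neg e1, ind_neg e2]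
  have h4 : tripSum (2 * k) (fun x y z => ind (¬ AllEven x y z ∧
        ((2 * k : ℕ) : ℤ) ∣ tqf a b c d e f x y z - n)) = 
        primCount (tqf a b c d e f) (2 * k) n := rfl
  omega

lemma prim_stable (a b c d e f : ℤ) (hG : GradCond a b c d e f) (r : ℕ) (n : ℤ) :
    primCount (tqf a b c d e f) (2 ^ (r + 3)) n = 4 ^ r * primCount (tqf a b c d e f) 8 n := by
  induction r with
  | zero => simp
  | succ r ih =>
    have := hensel_double a b c d e f hG (2 ^ (r + 2)) (by positivity) ⟨2 ^ r, by ring⟩ n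
    rw [show 4 * 2 ^ (r + 2) = 2 ^ (r + 1 + 3) by ring, show 2 * 2 ^ (r + 2) = 2 ^ (r + 3) by ring,
      ih] at this
    rw [this]; ring

lemma sol_split (a b c d e f : ℤ) (r : ℕ) (m : ℤ) :
    solCount (tqf a b c d e f) (2 ^ (r + 2)) (4 * m) =
      primCount (tqf a b c d e f) (2 ^ (r + 2)) (4 * m) + 8 * solCount (tqf a b c d e f) (2 ^ r) m := by
  have h1 : solCount (tqf a b c d e f) (2 ^ (r + 2)) (4 * m) =
      primCount (tqf a b c d e f) (2 ^ (r + 2)) (4 * m) + 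
      tripSum (2 ^ (r + 2)) (fun x y z => ind (AllEven x y z ∧ 
        ((2 ^ (r + 2) : ℕ) : ℤ) ∣ tqf a b c d e f x y z - 4 * m)) := by
    unfold solCount primCount
    rw [← tripSum_add]
    refine tripSum_congr _ fun x y z => ?_
    by_cases hA : AllEven x y z <;> simp only [hA, not_true_eq_false, not_false_eq_true, and_true, true_and, and_false,
        false_and, ind_true, ind_false, add_zero, zero_add]
  rw [h1]
  congr 1
  have h2 := tripSum_even (2 ^ (r + 1)) (fun x y z => ind (AllEven x y z ∧ 
        ((2 ^ (r + 2) : ℕ) : ℤ) ∣ tqf a b c d e f x y z - 4 * m)) (by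
          intro x y z h
          have h' : ¬ AllEven x y z := h
          exact ind_neg (fun hh => h' hh.1))
  rw [show 2 * 2 ^ (r + 1) = 2 ^ (r + 2) by ring] at h2
  rw [h2]
  have h3 := tripSum_two (2 ^ r) _ (sol_per a b c d e f (2 ^ r) m)
  rw [show 2 * 2 ^ r = 2 ^ (r + 1) by ring] at h3
  unfold solCount
  rw [← h3]
  refine tripSum_congr _ fun x y z => ind_congr ?_
  have hA : AllEven (2 * x) (2 * y) (2 * z) := ⟨⟨x, rfl⟩, ⟨y, rfl⟩, ⟨z, rfl⟩⟩
  simp only [hA, true_and]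
  rw [show tqf a b c d e f (2 * x) (2 * y) (2 * z) - 4 * m = 4 * (tqf a b c d e f x y z - m) by
    unfold tqf; ring]
  push_cast
  rw [show (2 : ℤ) ^ (r + 2) = 4 * 2 ^ r by ring]
  exact mul_dvd_mul_iff_left (by norm_num)

lemma sol_eq_prim (a b c d e f : ℤ) (r : ℕ) (m : ℤ) (hm : ¬ 4 ∣ m) :
    solCount (tqf a b c d e f) (2 ^ (r + 2)) m = primCount (tqf a b c d e f) (2 ^ (r + 2)) m := by
  refine tripSum_congr _ fun x y z => ind_congr ?_
  refine ⟨fun h => ⟨?_, h⟩, fun h => h.2⟩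
  rintro ⟨⟨x, rfl⟩, ⟨y, rfl⟩, ⟨z, rfl⟩⟩
  apply hm
  have h4 : (4 : ℤ) ∣ ((2 ^ (r + 2) : ℕ) : ℤ) := ⟨2 ^ r, by push_cast; ring⟩
  have h5 := h4.trans h
  have h6 : (4 : ℤ) ∣ tqf a b c d e f (2 * x) (2 * y) (2 * z) :=
    ⟨tqf a b c d e f x y z, by unfold tqf; ring⟩
  simpa using dvd_sub h6 h5

/-- The density of solutions, for all large moduli. -/
lemma sol_formula (a b c d e f : ℤ) (hG : GradCond a b c d e f) (C : ℕ)
    (h0 : primCount (tqf a b c d e f) 8 0 = C) (h4 : primCount (tqf a b c d e f) 8 4 = C)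
    (m : ℤ) (hm : ¬ 4 ∣ m) (k : ℕ) : ∀ r : ℕ,
    (solCount (tqf a b c d e f) (2 ^ (r + 3 + 2 * k)) (4 ^ k * m) : ℝ) / 4 ^ (r + 3 + 2 * k) =
      C / 32 + (primCount (tqf a b c d e f) 8 m / 64 - C / 32) * ((2 : ℝ) ^ k)⁻¹ := by
  induction k with
  | zero =>
    intro r
    have := sol_eq_prim a b c d e f (r + 1) m hm
    rw [show r + 1 + 2 = r + 3 by ring, prim_stable _ _ _ _ _ _ hG] at this
    simp only [mul_zero, add_zero, pow_zero, one_mul, this]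
    push_cast
    field_simp
    ring
  | succ k ih =>
    intro r
    have h := sol_split a b c d e f (r + 3 + 2 * k) (4 ^ k * m)
    rw [show r + 3 + 2 * k + 2 = (r + 2 * k + 2) + 3 by ring, prim_stable _ _ _ _ _ _ hG,
      show (4 : ℤ) * (4 ^ k * m) = 4 ^ (k + 1) * m by ring] at h
    have hC : primCount (tqf a b c d e f) 8 (4 ^ (k + 1) * m) = C := by
      rcases Int.emod_two_eq_zero_or_one (4 ^ k * m) with h | h
      · rw [← h0]; apply primCount_congr; rw [show (4 : ℤ) ^ (k + 1) * m = 4 * (4 ^ k * m) by ring]; push_cast; omega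
      · rw [← h4]; apply primCount_congr; rw [show (4 : ℤ) ^ (k + 1) * m = 4 * (4 ^ k * m) by ring]; push_cast; omega
    rw [hC] at h
    have ih' := ih r
    rw [show r + 3 + 2 * (k + 1) = r + 2 * k + 2 + 3 by ring, h]
    rw [div_eq_iff (by positivity)] at ih'
    push_cast
    rw [ih', div_eq_iff (by positivity)]
    field_simp
    ring

attribute [irreducible] tripSum

/-! ## Reduction modulo 8 -/

/-- Number of primitive solutions modulo `8`. -/
noncomputable def pc (a b c d e f n : ℤ) : ℕ := primCount (tqf a b c d e f) 8 n

lemma pc_congr {a b c d e f n a' b' c' d' e' f' n' : ℤ} (ha : 8 ∣ a - a') (hb : 8 ∣ b - b')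
    (hc : 8 ∣ c - c') (hd : 8 ∣ d - d') (he : 8 ∣ e - e') (hf : 8 ∣ f - f') (hn : 8 ∣ n - n') :
    pc a b c d e f n = pc a' b' c' d' e' f' n' := by
  refine tripSum_congr _ fun x y z => ind_congr ?_
  have : ((8 : ℕ) : ℤ) ∣ tqf a b c d e f x y z - n ↔ ((8 : ℕ) : ℤ) ∣ tqf a' b' c' d' e' f' x y z - n' := by
    apply dvd_iff_of_dvd_sub
    obtain ⟨ka, ha⟩ := ha
    obtain ⟨kb, hb⟩ := hb
    obtain ⟨kc, hc⟩ := hc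
    obtain ⟨kd, hd⟩ := hd
    obtain ⟨ke, he⟩ := he
    obtain ⟨kf, hf⟩ := hf
    obtain ⟨kn, hn⟩ := hn
    refine ⟨ka * x ^ 2 + kb * y ^ 2 + kc * z ^ 2 + kd * y * z + ke * x * z + kf * x * y - kn, ?_⟩
    unfold tqf; push_cast
    linear_combination x ^ 2 * ha + y ^ 2 * hb + z ^ 2 * hc + y * z * hd + x * z * he + x * y * hf - hn
  rw [this]

lemma pc_swap12 (a b c d e f n : ℤ) : pc a b c d e f n = pc b a c e d f n := by
  unfold pc primCount
  rw [tripSum_swap12]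
  refine tripSum_congr _ fun x y z => ind_congr ?_
  have h1 : AllEven y x z ↔ AllEven x y z := by unfold AllEven; tauto
  have h2 : tqf a b c d e f y x z = tqf b a c e d f x y z := by unfold tqf; ring
  rw [h1, h2]

lemma pc_swap23 (a b c d e f n : ℤ) : pc a b c d e f n = pc a c b d f e n := by
  unfold pc primCount
  rw [tripSum_swap23]
  refine tripSum_congr _ fun x y z => ind_congr ?_
  have h1 : AllEven x z y ↔ AllEven x y z := by unfold AllEven; tauto
  have h2 : tqf a b c d e f x z y = tqf a c b d f e x y z := by unfold tqf; ring
  rw [h1, h2]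

lemma pc_shear1 (a b c d e f n k l : ℤ) : pc a b c d e f n =
    pc a (b + a * k ^ 2 + f * k) (c + a * l ^ 2 + e * l) (d + 2 * a * k * l + e * k + f * l)
      (e + 2 * a * l) (f + 2 * a * k) n := by
  unfold pc primCount
  rw [← tripSum_shear1 8 _ (prim_per a b c d e f 8 (by norm_num) n) (fun y z => k * y + l * z)]
  refine tripSum_congr _ fun x y z => ind_congr ?_
  have h2 : tqf a b c d e f (x + (k * y + l * z)) y z = tqf a (b + a * k ^ 2 + f * k)
      (c + a * l ^ 2 + e * l) (d + 2 * a * k * l + e * k + f * l)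
      (e + 2 * a * l) (f + 2 * a * k) x y z := by unfold tqf; ring
  rw [h2]
  refine and_congr_left fun _ => not_congr ?_
  unfold AllEven
  constructor
  · rintro ⟨h1, h2, h3⟩
    refine ⟨?_, h2, h3⟩
    have := dvd_sub h1 (dvd_add (h2.mul_left k) (h3.mul_left l))
    simpa using this
  · rintro ⟨h1, h2, h3⟩
    exact ⟨dvd_add h1 (dvd_add (h2.mul_left k) (h3.mul_left l)), h2, h3⟩

lemma pc_shear2 (a b c d e f n k l : ℤ) : pc a b c d e f n =
    pc (a + b * k ^ 2 + f * k) b (c + b * l ^ 2 + d * l) (d + 2 * b * l)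
      (e + 2 * b * k * l + d * k + f * l) (f + 2 * b * k) n := by
  rw [pc_swap12, pc_shear1 b a c e d f n k l, pc_swap12]

lemma sum_scale (g : ℤ → ℕ) (h : ∀ x, g (x + (8 : ℕ)) = g x) (u : ℤ) (hu : ¬ 2 ∣ u) :
    ∑ i ∈ Finset.range 8, g (u * i) = ∑ i ∈ Finset.range 8, g i := by
  have hp : Function.Periodic g 8 := fun x => by simpa using h x
  have hg : ∀ x y : ℤ, x % 8 = y % 8 → g x = g y := by
    intro x y hxy
    have : x = y + ((x - y) / 8 : ℤ) • (8 : ℤ) := by simp; omega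
    rw [this, hp.zsmul]
  simp only [Finset.sum_range_succ, Finset.sum_range_zero]
  push_cast
  have h8 : u % 8 = 1 ∨ u % 8 = 3 ∨ u % 8 = 5 ∨ u % 8 = 7 := by omega
  rcases h8 with h8 | h8 | h8 | h8
  · rw [hg (u * 1) 1 (by omega), hg (u * 2) 2 (by omega), hg (u * 3) 3 (by omega),
      hg (u * 4) 4 (by omega), hg (u * 5) 5 (by omega), hg (u * 6) 6 (by omega),
      hg (u * 7) 7 (by omega), mul_zero]
  · rw [hg (u * 1) 3 (by omega), hg (u * 2) 6 (by omega), hg (u * 3) 1 (by omega),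
      hg (u * 4) 4 (by omega), hg (u * 5) 7 (by omega), hg (u * 6) 2 (by omega),
      hg (u * 7) 5 (by omega), mul_zero]
    ring
  · rw [hg (u * 1) 5 (by omega), hg (u * 2) 2 (by omega), hg (u * 3) 7 (by omega),
      hg (u * 4) 4 (by omega), hg (u * 5) 1 (by omega), hg (u * 6) 6 (by omega),
      hg (u * 7) 3 (by omega), mul_zero]
    ring
  · rw [hg (u * 1) 7 (by omega), hg (u * 2) 6 (by omega), hg (u * 3) 5 (by omega),
      hg (u * 4) 4 (by omega), hg (u * 5) 3 (by omega), hg (u * 6) 2 (by omega),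
      hg (u * 7) 1 (by omega), mul_zero]
    ring

lemma pc_scale3 (a b c d e f n u : ℤ) (hu : ¬ 2 ∣ u) : pc a b c d e f n =
    pc a b (c * u ^ 2) (d * u) (e * u) f n := by
  have hper := prim_per a b c d e f 8 (by norm_num) n
  have h1 : pc a b c d e f n = tripSum 8 (fun x y z => ind (¬ AllEven x y (u * z) ∧
      ((8 : ℕ) : ℤ) ∣ tqf a b c d e f x y (u * z) - n)) := by
    unfold pc primCount tripSum
    refine Finset.sum_congr rfl fun i _ => Finset.sum_congr rfl fun j _ => ?_
    exact (sum_scale (fun z => ind (¬ AllEven i j z ∧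
      ((8 : ℕ) : ℤ) ∣ tqf a b c d e f i j z - n)) (fun z => hper.2.2 _ _ _) u hu).symm
  rw [h1]
  refine tripSum_congr _ fun x y z => ind_congr ?_
  have h2 : tqf a b c d e f x y (u * z) = tqf a b (c * u ^ 2) (d * u) (e * u) f x y z := by
    unfold tqf; ring
  have h3 : AllEven x y (u * z) ↔ AllEven x y z := by
    unfold AllEven
    rw [Int.prime_two.dvd_mul]
    tauto
  rw [h2, h3]

/-! ### Computation of the counts -/

/-- Kernel-friendly summation. -/
def natLoop (M : ℕ) (f : ℕ → ℕ) : ℕ := Nat.rec 0 (fun k acc => acc + f k) M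

lemma natLoop_eq (M : ℕ) (f : ℕ → ℕ) : ∑ i ∈ Finset.range M, f i = natLoop M f := by
  induction M with
  | zero => rfl
  | succ M ih => rw [Finset.sum_range_succ, ih]; rfl

/-- Kernel-friendly count of primitive solutions. -/
def cntN (M a b c d f n : ℕ) : ℕ :=
  natLoop M fun x => natLoop M fun y => natLoop M fun z =>
    bif (Nat.beq (x % 2) 1 || Nat.beq (y % 2) 1 || Nat.beq (z % 2) 1) &&
      Nat.beq ((a * (x * x) + b * (y * y) + c * (z * z) + d * (y * z) + f * (x * y)) % 8) (n % 8)
    then 1 else 0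

lemma cntN_eq (M a b c d f n : ℕ) : tripSum M (fun x y z => ind (¬ AllEven x y z ∧
      ((8 : ℕ) : ℤ) ∣ tqf a b c d 0 f x y z - n)) = cntN M a b c d f n := by
  unfold tripSum cntN
  simp only [← natLoop_eq]
  refine Finset.sum_congr rfl fun i _ => Finset.sum_congr rfl fun j _ => Finset.sum_congr rfl fun k _ => ?_
  have h1 : (¬ AllEven i j k) ↔ (Nat.beq (i % 2) 1 || Nat.beq (j % 2) 1 || Nat.beq (k % 2) 1) = true := by
    unfold AllEven
    simp only [Bool.or_eq_true, Nat.beq_eq]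
    omega
  have h2 : ((8 : ℕ) : ℤ) ∣ tqf a b c d 0 f i j k - n ↔
    Nat.beq ((a * (i * i) + b * (j * j) + c * (k * k) + d * (j * k) + f * (i * j)) % 8) (n % 8) = true := by
    have : tqf a b c d 0 f i j k =
      ((a * (i * i) + b * (j * j) + c * (k * k) + d * (j * k) + f * (i * j) : ℕ) : ℤ) := by
      unfold tqf; push_cast; ring
    rw [this]
    simp only [Nat.beq_eq]
    omega
  rw [h1, h2, ← Bool.and_eq_true]
  cases hB : ((Nat.beq (i % 2) 1 || Nat.beq (j % 2) 1 || Nat.beq (k % 2) 1) && 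
    Nat.beq ((a * (i * i) + b * (j * j) + c * (k * k) + d * (j * k) + f * (i * j)) % 8) (n % 8))
  · exact ind_neg (by simp)
  · exact ind_pos rfl

lemma pc_eq_cnt8 (a b c d f n : ℕ) : pc a b c d 0 f n = cntN 8 a b c d f n := cntN_eq 8 a b c d f n

lemma pc_eq_cnt4 (a b c d n : ℕ) : pc a b c (2 * d : ℕ) 0 0 n = 8 * cntN 4 a b c (2 * d) 0 n := by
  rw [← cntN_eq]
  have hp : Per3 4 (fun x y z => ind (¬ AllEven x y z ∧
      ((8 : ℕ) : ℤ) ∣ tqf a b c (2 * d : ℕ) 0 (0 : ℕ) x y z - n)) := by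
    refine per3_of _ _ fun x y z u v w => ind_congr ?_
    rw [allEven_add _ _ _ _ _ _ (by omega) (by omega) (by omega)]
    have : ((8 : ℕ) : ℤ) ∣ tqf a b c (2 * d : ℕ) 0 (0 : ℕ) (x + (4 : ℕ) * u) (y + (4 : ℕ) * v)
        (z + (4 : ℕ) * w) - n ↔ ((8 : ℕ) : ℤ) ∣ tqf a b c (2 * d : ℕ) 0 (0 : ℕ) x y z - n := by
      apply dvd_iff_of_dvd_sub
      refine ⟨a * (x * u + 2 * u ^ 2) + b * (y * v + 2 * v ^ 2) + c * (z * w + 2 * w ^ 2)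
        + d * (y * w + v * z + 4 * v * w), ?_⟩
      unfold tqf; push_cast; ring
    rw [this]
  exact tripSum_two 4 _ hp

/-- Table of counts for an odd lattice of determinant `D`, anisotropic case. -/
def TabAniso (P : ℤ → ℕ) (D : ℤ) : Prop :=
  P 0 = 0 ∧ P 4 = 0 ∧ P 2 = 96 ∧ P 6 = 96 ∧ P D = 96 ∧ P (D + 4) = 96 ∧ P (3 * D) = 64 ∧
    P (7 * D) = 0

/-- Table of counts for an odd lattice of determinant `D`, isotropic case. -/
def TabIso (P : ℤ → ℕ) (D : ℤ) : Prop :=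
  P 0 = 64 ∧ P 4 = 64 ∧ P 2 = 32 ∧ P 6 = 32 ∧ P D = 32 ∧ P (D + 4) = 32 ∧ P (3 * D) = 64 ∧
    P (7 * D) = 128

/-- Table of counts for half of an even lattice of determinant `2 D`. -/
def TabEven (P : ℤ → ℕ) (D : ℤ) : Prop :=
  P 0 = 48 ∧ P 4 = 48 ∧ P 2 = 48 ∧ P 6 = 48 ∧ P D = 48 ∧ P (D + 4) = 48 ∧ P (3 * D) = 64 ∧
    P (7 * D) = 96

/-- Kernel-friendly table comparison. -/
def chk (p : ℕ → ℕ) (D v0 v4 v2 v6 v1 v5 v3 v7 : ℕ) : Bool :=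
  Nat.beq (p 0) v0 && Nat.beq (p 4) v4 && Nat.beq (p 2) v2 && Nat.beq (p 6) v6 &&
    Nat.beq (p D) v1 && Nat.beq (p (D + 4)) v5 && Nat.beq (p (3 * D)) v3 && Nat.beq (p (7 * D)) v7

/-- Kernel-friendly check of the odd tables. -/
def chkOdd (p : ℕ → ℕ) (D : ℕ) : Bool :=
  chk p D 0 0 12 12 12 12 8 0 || chk p D 8 8 4 4 4 4 8 16

lemma chk_diag : ([1, 3, 5, 7].all fun a => [1, 3, 5, 7].all fun b => [1, 3, 5, 7].all fun c =>
    chkOdd (cntN 4 a b c (2 * 0) 0) (a * b * c)) = true := by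
  decide +kernel

lemma chk_block : ([1, 3, 5, 7].all fun a => [0, 2, 4, 6].all fun b => [0, 2, 4, 6].all fun c =>
    chkOdd (cntN 4 a b c (2 * 1) 0) (a * (b * c + 7))) = true := by
  decide +kernel

lemma chk_even : ([1, 3, 5, 7].all fun c =>
    chk (cntN 8 0 0 c 0 1) (7 * c) 48 48 48 48 48 48 64 96) = true := by
  decide +kernel
/-! ### The tables -/

lemma odd_sq {a : ℤ} (h : ¬ 2 ∣ a) : ∃ t, a ^ 2 - 1 = 8 * t := by
  obtain ⟨k, rfl⟩ : ∃ k, a = 2 * k + 1 := ⟨a / 2, by omega⟩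
  obtain ⟨m, hm⟩ := Int.even_mul_succ_self k
  exact ⟨m, by linear_combination 4 * hm⟩

/-- Table of counts for an odd lattice. -/
def OddTab (P : ℤ → ℕ) (D : ℤ) : Prop := TabAniso P D ∨ TabIso P D

lemma tab_congr {a b c d e f a' b' c' d' e' f' D D' : ℤ} (T : (ℤ → ℕ) → ℤ → Prop)
    (hT : ∀ P D D', (∀ n m, 8 ∣ n - m → P n = P m) → 8 ∣ D - D' → T P D' → T P D)
    (h : ∀ n, pc a b c d e f n = pc a' b' c' d' e' f' n) (hD : 8 ∣ D - D')
    (h' : T (pc a' b' c' d' e' f') D') : T (pc a b c d e f) D := by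
  rw [show pc a b c d e f = pc a' b' c' d' e' f' from funext h]
  refine hT _ _ _ (fun n m hnm => ?_) hD h'
  exact pc_congr (by simp) (by simp) (by simp) (by simp) (by simp) (by simp) hnm

lemma tabAniso_congr (P : ℤ → ℕ) (D D' : ℤ) (hP : ∀ n m, 8 ∣ n - m → P n = P m) (h : 8 ∣ D - D')
    (hT : TabAniso P D') : TabAniso P D := by
  unfold TabAniso at *
  rw [hP D D' h, hP (D + 4) (D' + 4) (by omega), hP (3 * D) (3 * D') (by omega),
    hP (7 * D) (7 * D') (by omega)]
  exact hT

lemma tabIso_congr (P : ℤ → ℕ) (D D' : ℤ) (hP : ∀ n m, 8 ∣ n - m → P n = P m) (h : 8 ∣ D - D')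
    (hT : TabIso P D') : TabIso P D := by
  unfold TabIso at *
  rw [hP D D' h, hP (D + 4) (D' + 4) (by omega), hP (3 * D) (3 * D') (by omega),
    hP (7 * D) (7 * D') (by omega)]
  exact hT

lemma tabEven_congr (P : ℤ → ℕ) (D D' : ℤ) (hP : ∀ n m, 8 ∣ n - m → P n = P m) (h : 8 ∣ D - D')
    (hT : TabEven P D') : TabEven P D := by
  unfold TabEven at *
  rw [hP D D' h, hP (D + 4) (D' + 4) (by omega), hP (3 * D) (3 * D') (by omega),
    hP (7 * D) (7 * D') (by omega)]
  exact hT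

lemma oddTab_congr (P : ℤ → ℕ) (D D' : ℤ) (hP : ∀ n m, 8 ∣ n - m → P n = P m) (h : 8 ∣ D - D')
    (hT : OddTab P D') : OddTab P D :=
  hT.imp (tabAniso_congr P D D' hP h) (tabIso_congr P D D' hP h)

lemma chk_spec (P : ℤ → ℕ) (p : ℕ → ℕ) (s : ℕ) (hP : ∀ n : ℕ, P n = s * p n)
    (D v0 v4 v2 v6 v1 v5 v3 v7 : ℕ) (h : chk p D v0 v4 v2 v6 v1 v5 v3 v7 = true) :
    P 0 = s * v0 ∧ P 4 = s * v4 ∧ P 2 = s * v2 ∧ P 6 = s * v6 ∧ P D = s * v1 ∧ P (D + 4) = s * v5 ∧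
      P (3 * D) = s * v3 ∧ P (7 * D) = s * v7 := by
  simp only [chk, Bool.and_eq_true, Nat.beq_eq] at h
  obtain ⟨⟨⟨⟨⟨⟨⟨h0, h4⟩, h2⟩, h6⟩, h1⟩, h5⟩, h3⟩, h7⟩ := h
  rw [← h0, ← h4, ← h2, ← h6, ← h1, ← h5, ← h3, ← h7, ← hP, ← hP, ← hP, ← hP, ← hP, ← hP, ← hP, ← hP]
  push_cast
  simp only [and_self]

lemma chkOdd_spec (P : ℤ → ℕ) (p : ℕ → ℕ) (hP : ∀ n : ℕ, P n = 8 * p n)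
    (D : ℕ) (h : chkOdd p D = true) : OddTab P D := by
  unfold chkOdd at h
  rw [Bool.or_eq_true] at h
  rcases h with h | h
  · exact Or.inl (chk_spec P p 8 hP D _ _ _ _ _ _ _ _ h)
  · exact Or.inr (chk_spec P p 8 hP D _ _ _ _ _ _ _ _ h)

lemma odd_res {a : ℤ} (h : ¬ 2 ∣ a) : ∃ a' : ℕ, a' ∈ [1, 3, 5, 7] ∧ 8 ∣ a - a' := by
  refine ⟨(a % 8).toNat, ?_, by omega⟩
  simp only [List.mem_cons, List.not_mem_nil, or_false]
  omega

lemma even_res {a : ℤ} (h : 2 ∣ a) : ∃ a' : ℕ, a' ∈ [0, 2, 4, 6] ∧ 8 ∣ a - a' := by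
  refine ⟨(a % 8).toNat, ?_, by omega⟩
  simp only [List.mem_cons, List.not_mem_nil, or_false]
  omega

lemma oddTab_diag (a b c : ℤ) (ha : ¬ 2 ∣ a) (hb : ¬ 2 ∣ b) (hc : ¬ 2 ∣ c) :
    OddTab (pc a b c 0 0 0) (a * b * c) := by
  obtain ⟨a', ma, ha⟩ := odd_res ha
  obtain ⟨b', mb, hb⟩ := odd_res hb
  obtain ⟨c', mc, hc⟩ := odd_res hc
  have h := chk_diag
  simp only [List.all_eq_true] at h
  have h1 := chkOdd_spec (pc a' b' c' ((2 * 0 : ℕ) : ℤ) 0 0) _ (fun n => pc_eq_cnt4 a' b' c' 0 n) _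
    (h a' ma b' mb c' mc)
  refine tab_congr OddTab oddTab_congr (fun n => ?_) ?_ h1
  · exact pc_congr ha hb hc (by simp) (by simp) (by simp) (by simp)
  · push_cast
    obtain ⟨s, hs⟩ := ha
    obtain ⟨t, ht⟩ := hb
    obtain ⟨u, hu⟩ := hc
    exact ⟨s * b * c + a' * t * c + a' * b' * u, by
      linear_combination b * c * hs + a' * c * ht + a' * b' * hu⟩

lemma oddTab_block (a b c : ℤ) (ha : ¬ 2 ∣ a) (hb : 2 ∣ b) (hc : 2 ∣ c) :
    OddTab (pc a b c 2 0 0) (a * (b * c - 1)) := by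
  obtain ⟨a', ma, ha⟩ := odd_res ha
  obtain ⟨b', mb, hb⟩ := even_res hb
  obtain ⟨c', mc, hc⟩ := even_res hc
  have h := chk_block
  simp only [List.all_eq_true] at h
  have h1 := chkOdd_spec (pc a' b' c' ((2 * 1 : ℕ) : ℤ) 0 0) _ (fun n => pc_eq_cnt4 a' b' c' 1 n) _
    (h a' ma b' mb c' mc)
  refine tab_congr OddTab oddTab_congr (fun n => ?_) ?_ h1
  · exact pc_congr ha hb hc (by simp) (by simp) (by simp) (by simp)
  · push_cast
    obtain ⟨s, hs⟩ := ha
    obtain ⟨t, ht⟩ := hb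
    obtain ⟨u, hu⟩ := hc
    exact ⟨s * (b * c - 1) + a' * t * c + a' * b' * u - a', by
      linear_combination (b * c - 1) * hs + a' * c * ht + a' * b' * hu⟩

lemma oddTab_ortho2 (a b c d : ℤ) (ha : ¬ 2 ∣ a) (hb : ¬ 2 ∣ b) (hD : ¬ 2 ∣ a * (b * c - d ^ 2)) :
    OddTab (pc a b c (2 * d) 0 0) (a * (b * c - d ^ 2)) := by
  obtain ⟨t, ht⟩ := odd_sq hb
  have hdvd : (8 : ℤ) ∣ a * (b * c - d ^ 2) - a * b * (c + b ^ 3 * d ^ 2 - 2 * b * d ^ 2) :=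
    ⟨-(8 * t ^ 2 * a * d ^ 2), by linear_combination (-(b ^ 2 - 1 + 8 * t) * a * d ^ 2) * ht⟩
  have hc' : ¬ 2 ∣ c + b ^ 3 * d ^ 2 - 2 * b * d ^ 2 := by
    intro h
    have := h.mul_left (a * b)
    omega
  refine tab_congr OddTab oddTab_congr (fun n => ?_) hdvd (oddTab_diag a b _ ha hb hc')
  rw [pc_shear2 _ _ _ _ _ _ _ 0 (-(b * d))]
  refine pc_congr ⟨0, by ring⟩ ⟨0, by ring⟩ ⟨0, by ring⟩ ⟨-(2 * d * t), ?_⟩ ⟨0, by ring⟩ ⟨0, by ring⟩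
    ⟨0, by ring⟩
  linear_combination -(2 * d) * ht

lemma oddTab_step2 (a b c d : ℤ) (ha : ¬ 2 ∣ a) (hD : ¬ 2 ∣ a * (b * c - d ^ 2)) :
    OddTab (pc a b c (2 * d) 0 0) (a * (b * c - d ^ 2)) := by
  by_cases hb : 2 ∣ b
  swap
  · exact oddTab_ortho2 a b c d ha hb hD
  by_cases hc : 2 ∣ c
  swap
  · rw [mul_comm b c] at hD ⊢
    refine tab_congr OddTab oddTab_congr (fun n => ?_) ⟨0, by ring⟩ (oddTab_ortho2 a c b d ha hc hD)
    rw [pc_swap23]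
  have hd : ¬ 2 ∣ d := by
    intro h
    apply hD
    exact (dvd_sub (hb.mul_right c) (dvd_pow h two_ne_zero)).mul_left a
  obtain ⟨t, ht⟩ := odd_sq hd
  refine tab_congr OddTab oddTab_congr (fun n => ?_) ⟨-(a * t), ?_⟩ (oddTab_block a b c ha hb hc)
  · rw [pc_scale3 _ _ _ _ _ _ _ d hd]
    refine pc_congr ⟨0, by ring⟩ ⟨0, by ring⟩ ⟨c * t, ?_⟩ ⟨2 * t, ?_⟩ ⟨0, by ring⟩ ⟨0, by ring⟩
      ⟨0, by ring⟩
    · linear_combination c * ht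
    · linear_combination 2 * ht
  · linear_combination -a * ht

lemma oddTab_step1 (a b c d e f : ℤ) (ha : ¬ 2 ∣ a)
    (hD : ¬ 2 ∣ a * b * c + 2 * d * e * f - a * d ^ 2 - b * e ^ 2 - c * f ^ 2) :
    OddTab (pc a b c (2 * d) (2 * e) (2 * f))
      (a * b * c + 2 * d * e * f - a * d ^ 2 - b * e ^ 2 - c * f ^ 2) := by
  obtain ⟨t, ht⟩ := odd_sq ha
  have hdvd : (8 : ℤ) ∣ (a * b * c + 2 * d * e * f - a * d ^ 2 - b * e ^ 2 - c * f ^ 2) -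
      a * ((b + a ^ 3 * f ^ 2 - 2 * a * f ^ 2) * (c + a ^ 3 * e ^ 2 - 2 * a * e ^ 2)
        - (d + a ^ 3 * e * f - 2 * a * e * f) ^ 2) :=
    ⟨-(8 * t ^ 2 * (b * e ^ 2 + c * f ^ 2 - 2 * d * e * f)), by
      linear_combination (-(a ^ 2 - 1 + 8 * t) * (b * e ^ 2 + c * f ^ 2 - 2 * d * e * f)) * ht⟩
  refine tab_congr OddTab oddTab_congr (fun n => ?_) hdvd (oddTab_step2 a _ _ _ ha ?_)
  · rw [pc_shear1 _ _ _ _ _ _ _ (-(a * f)) (-(a * e))]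
    refine pc_congr ⟨0, by ring⟩ ⟨0, by ring⟩ ⟨0, by ring⟩ ⟨0, by ring⟩ ⟨-(2 * e * t), ?_⟩
      ⟨-(2 * f * t), ?_⟩ ⟨0, by ring⟩
    · linear_combination -(2 * e) * ht
    · linear_combination -(2 * f) * ht
  · intro h; apply hD; omega

lemma oddTab_main (a b c d e f : ℤ) (hodd : ¬ 2 ∣ a ∨ ¬ 2 ∣ b ∨ ¬ 2 ∣ c)
    (hD : ¬ 2 ∣ a * b * c + 2 * d * e * f - a * d ^ 2 - b * e ^ 2 - c * f ^ 2) :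
    OddTab (pc a b c (2 * d) (2 * e) (2 * f))
      (a * b * c + 2 * d * e * f - a * d ^ 2 - b * e ^ 2 - c * f ^ 2) := by
  rcases hodd with h | h | h
  · exact oddTab_step1 a b c d e f h hD
  · refine tab_congr OddTab oddTab_congr (fun n => pc_swap12 ..) ⟨0, ?_⟩
      (oddTab_step1 b a c e d f h ?_)
    · ring
    · rwa [show b * a * c + 2 * e * d * f - b * e ^ 2 - a * d ^ 2 - c * f ^ 2 =
        a * b * c + 2 * d * e * f - a * d ^ 2 - b * e ^ 2 - c * f ^ 2 by ring]
  · refine tab_congr OddTab oddTab_congr (fun n => ?_) ⟨0, ?_⟩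
      (oddTab_step1 c a b f d e h ?_)
    · rw [pc_swap23, pc_swap12]
    · ring
    · rwa [show c * a * b + 2 * f * d * e - c * f ^ 2 - a * d ^ 2 - b * e ^ 2 =
        a * b * c + 2 * d * e * f - a * d ^ 2 - b * e ^ 2 - c * f ^ 2 by ring]

/-! ### The even table -/

lemma pc_scale2 (a b c d e f n u : ℤ) (hu : ¬ 2 ∣ u) : pc a b c d e f n =
    pc a (b * u ^ 2) c (d * u) e (f * u) n := by
  rw [pc_swap23, pc_scale3 _ _ _ _ _ _ _ u hu, pc_swap23]

lemma evenTab_base (c : ℤ) (hc : ¬ 2 ∣ c) : TabEven (pc 0 0 c 0 0 1) (-c) := by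
  obtain ⟨c', mc, hc⟩ := odd_res hc
  have h := chk_even
  simp only [List.all_eq_true] at h
  have h1 : TabEven (pc (0 : ℕ) (0 : ℕ) c' (0 : ℕ) 0 (1 : ℕ)) ((7 * c' : ℕ) : ℤ) := 
    chk_spec (pc (0 : ℕ) (0 : ℕ) c' (0 : ℕ) 0 (1 : ℕ)) _ 1
    (fun n => (pc_eq_cnt8 0 0 c' 0 1 n).trans (one_mul _).symm) _ _ _ _ _ _ _ _ _ (h c' mc)
  refine tab_congr TabEven tabEven_congr (fun n => ?_) ?_ h1
  · exact pc_congr (by simp) (by simp) hc (by simp) (by simp) (by simp) (by simp)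
  · push_cast; omega

lemma evenTab_final (a b c : ℤ) (ha : 2 ∣ a) (hc : ¬ 2 ∣ c) :
    TabEven (pc a b c 0 0 1) ((4 * a * b - 1) * c) := by
  obtain ⟨s, rfl⟩ := ha
  set k := -(2 * s) - b * (2 * s) ^ 2 with hk
  have hf : ¬ 2 ∣ 1 + 2 * b * k := by
    rw [mul_assoc]; omega
  obtain ⟨t, ht⟩ := odd_sq hf
  refine tab_congr TabEven tabEven_congr (fun n => ?_) ⟨s * b * c, by ring⟩ (evenTab_base c hc)
  rw [pc_shear2 _ _ _ _ _ _ _ k 0,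
    pc_congr (a' := 0) (b' := b) (c' := c) (d' := 0) (e' := 0) (f' := 1 + 2 * b * k) (n' := n)
      ⟨2 * b ^ 2 * s ^ 3 + 2 * b ^ 3 * s ^ 4, by rw [hk]; ring⟩ ⟨0, by ring⟩ ⟨0, by ring⟩
      ⟨0, by ring⟩ ⟨0, by ring⟩ ⟨0, by ring⟩ ⟨0, by ring⟩,
    pc_shear1 _ _ _ _ _ _ _ (-(b * (1 + 2 * b * k))) 0,
    pc_scale2 _ _ _ _ _ _ _ (1 + 2 * b * k) hf]
  refine pc_congr ⟨0, by ring⟩ ⟨-(b * t * (1 + 2 * b * k) ^ 2), ?_⟩ ⟨0, by ring⟩ ⟨0, by ring⟩ ⟨0, by ring⟩ ⟨t, ?_⟩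
      ⟨0, by ring⟩
  · linear_combination (-b * (1 + 2 * b * k) ^ 2) * ht
  · linear_combination ht

lemma even_ortho (a b c d e : ℤ) : ∃ c', (∀ n, pc a b c d e 1 n = pc a b c' 0 0 1 n) ∧
    8 ∣ (4 * a * b * c + d * e - a * d ^ 2 - b * e ^ 2 - c) - (4 * a * b - 1) * c' := by
  set K := (1 + 4 * a * b) * (2 * b * e - d) with hK
  set L := -(e + 2 * a * K) with hL
  refine ⟨c + a * K ^ 2 + e * K + b * L ^ 2 + (d + K) * L, fun n => ?_, ?_⟩
  · rw [pc_shear1 _ _ _ _ _ _ _ 0 K, pc_shear2 _ _ _ _ _ _ _ 0 L]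
    refine pc_congr ⟨0, by ring⟩ ⟨0, by ring⟩ ⟨0, by ring⟩ ⟨2 * a ^ 2 * b ^ 2 * (d - 2 * b * e), ?_⟩
      ⟨0, by rw [hL]; ring⟩ ⟨0, by ring⟩ ⟨0, by ring⟩
    rw [hL, hK]; ring
  · have h1 : d + K + 2 * b * L = 8 * (2 * a ^ 2 * b ^ 2 * (d - 2 * b * e)) := by
      rw [hL, hK]; ring
    have h2 : e + 2 * a * K + L = 0 := by rw [hL]; ring
    refine ⟨-a * (d + K + 2 * b * L) * (2 * a ^ 2 * b ^ 2 * (d - 2 * b * e)), ?_⟩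
    linear_combination -a * (d + K + 2 * b * L) * h1
      + ((d + K + 2 * b * L) - b * (e + 2 * a * K + L)) * h2

lemma evenTab_a (a b c d e : ℤ) (ha : 2 ∣ a)
    (hD : ¬ 2 ∣ 4 * a * b * c + d * e - a * d ^ 2 - b * e ^ 2 - c) :
    TabEven (pc a b c d e 1) (4 * a * b * c + d * e - a * d ^ 2 - b * e ^ 2 - c) := by
  obtain ⟨c', h1, h2⟩ := even_ortho a b c d e
  refine tab_congr TabEven tabEven_congr h1 h2 (evenTab_final a b c' ha ?_)
  intro h
  have := h.mul_left (4 * a * b - 1)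
  omega

lemma evenTab_one (a b c d e : ℤ) 
    (hD : ¬ 2 ∣ 4 * a * b * c + d * e - a * d ^ 2 - b * e ^ 2 - c) :
    TabEven (pc a b c d e 1) (4 * a * b * c + d * e - a * d ^ 2 - b * e ^ 2 - c) := by
  by_cases ha : 2 ∣ a
  · exact evenTab_a a b c d e ha hD
  by_cases hb : 2 ∣ b
  · refine tab_congr TabEven tabEven_congr (fun n => pc_swap12 ..) ⟨0, ?_⟩
      (evenTab_a b a c e d hb ?_)
    · ring
    · rwa [show 4 * b * a * c + e * d - b * e ^ 2 - a * d ^ 2 - c =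
        4 * a * b * c + d * e - a * d ^ 2 - b * e ^ 2 - c by ring]
  obtain ⟨c', h1, h2⟩ := even_ortho a b c d e
  have hc : ¬ 2 ∣ c' := by
    intro h
    have := h.mul_left (4 * a * b - 1)
    omega
  have e1 : 4 * (a + c') * b * c' + 0 * (2 * c') - (a + c') * 0 ^ 2 - b * (2 * c') ^ 2 - c'
    = (4 * a * b - 1) * c' := by ring
  refine tab_congr TabEven tabEven_congr h1 (by rw [← e1] at h2; exact h2)
    (tab_congr TabEven tabEven_congr (fun n => ?_) ⟨0, by ring⟩
      (evenTab_a (a + c') b c' 0 (2 * c') (by omega) ?_))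
  · rw [pc_swap23, pc_shear2 _ _ _ _ _ _ _ 1 0, pc_swap23]
    exact pc_congr ⟨0, by ring⟩ ⟨0, by ring⟩ ⟨0, by ring⟩ ⟨0, by ring⟩ ⟨0, by ring⟩ ⟨0, by ring⟩
      ⟨0, by ring⟩
  · rw [e1]; omega

lemma evenTab_f (a b c d e f : ℤ) (hf : ¬ 2 ∣ f)
    (hD : ¬ 2 ∣ 4 * a * b * c + d * e * f - a * d ^ 2 - b * e ^ 2 - c * f ^ 2) :
    TabEven (pc a b c d e f) (4 * a * b * c + d * e * f - a * d ^ 2 - b * e ^ 2 - c * f ^ 2) := by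
  obtain ⟨t, ht⟩ := odd_sq hf
  have hdvd : (8 : ℤ) ∣ (4 * a * b * c + d * e * f - a * d ^ 2 - b * e ^ 2 - c * f ^ 2) -
      (4 * a * (b * f ^ 2) * c + (d * f) * e - a * (d * f) ^ 2 - (b * f ^ 2) * e ^ 2 - c) :=
    ⟨-(4 * a * b * c - a * d ^ 2 - b * e ^ 2 + c) * t, by
      linear_combination -(4 * a * b * c - a * d ^ 2 - b * e ^ 2 + c) * ht⟩
  refine tab_congr TabEven tabEven_congr (fun n => ?_) hdvd (evenTab_one _ _ _ _ _ ?_)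
  · rw [pc_scale2 _ _ _ _ _ _ _ f hf]
    refine pc_congr ⟨0, by ring⟩ ⟨0, by ring⟩ ⟨0, by ring⟩ ⟨0, by ring⟩ ⟨0, by ring⟩ ⟨t, ?_⟩
      ⟨0, by ring⟩
    linear_combination ht
  · omega

lemma evenTab_main (a b c d e f : ℤ)
    (hD : ¬ 2 ∣ 4 * a * b * c + d * e * f - a * d ^ 2 - b * e ^ 2 - c * f ^ 2) :
    TabEven (pc a b c d e f) (4 * a * b * c + d * e * f - a * d ^ 2 - b * e ^ 2 - c * f ^ 2) := by
  by_cases hf : 2 ∣ f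
  swap
  · exact evenTab_f a b c d e f hf hD
  by_cases he : 2 ∣ e
  swap
  · refine tab_congr TabEven tabEven_congr (fun n => pc_swap23 ..) ⟨0, ?_⟩
      (evenTab_f a c b d f e he ?_)
    · ring
    · rwa [show 4 * a * c * b + d * f * e - a * d ^ 2 - c * f ^ 2 - b * e ^ 2 =
        4 * a * b * c + d * e * f - a * d ^ 2 - b * e ^ 2 - c * f ^ 2 by ring]
  by_cases hd : 2 ∣ d
  · exfalso
    apply hD
    obtain ⟨f, rfl⟩ := hf
    obtain ⟨e, rfl⟩ := he
    obtain ⟨d, rfl⟩ := hd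
    exact ⟨2 * a * b * c + 4 * d * e * f - 2 * a * d ^ 2 - 2 * b * e ^ 2 - 2 * c * f ^ 2, by ring⟩
  · refine tab_congr TabEven tabEven_congr (fun n => ?_) ⟨0, ?_⟩
      (evenTab_f b c a e f d hd ?_)
    · rw [pc_swap12, pc_swap23]
    · ring
    · rwa [show 4 * b * c * a + e * f * d - b * e ^ 2 - c * f ^ 2 - a * d ^ 2 =
        4 * a * b * c + d * e * f - a * d ^ 2 - b * e ^ 2 - c * f ^ 2 by ring]


lemma zmod_sum (M : ℕ) [NeZero M] (g : ZMod M → ℕ) :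
    ∑ x : ZMod M, g x = ∑ i ∈ Finset.range M, g ((i : ℤ) : ZMod M) := by
  refine Finset.sum_nbij' (fun x => x.val) (fun i => (i : ZMod M)) ?_ ?_ ?_ ?_ ?_
  · intro x _
    exact Finset.mem_range.2 (ZMod.val_lt x)
  · intro i _
    exact Finset.mem_univ _
  · intro x _
    simp
  · intro i hi
    exact ZMod.val_cast_of_lt (Finset.mem_range.1 hi)
  · intro x _
    simp

/-- Triples as functions. -/
def tripEquiv (α : Type) : (Fin 3 → α) ≃ α × α × α where
  toFun X := (X 0, X 1, X 2)
  invFun p := ![p.1, p.2.1, p.2.2]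
  left_inv X := by
    funext i
    fin_cases i <;> rfl
  right_inv p := rfl

lemma card_trip (M : ℕ) [NeZero M] (P : (Fin 3 → ZMod M) → Prop) :
    Nat.card {X : Fin 3 → ZMod M // P X} =
      tripSum M (fun x y z => ind (P ![(x : ZMod M), (y : ZMod M), (z : ZMod M)])) := by
  have h1 : Nat.card {X : Fin 3 → ZMod M // P X} = ∑ X : Fin 3 → ZMod M, ind (P X) := by
    rw [Nat.card_eq_fintype_card, Fintype.card_subtype, Finset.card_filter]
    rfl
  have h2 : ∑ X : Fin 3 → ZMod M, ind (P X) =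
      ∑ p : ZMod M × ZMod M × ZMod M, ind (P ![p.1, p.2.1, p.2.2]) := by
    refine Fintype.sum_equiv (tripEquiv (ZMod M)) _ _ ?_
    intro X
    have : ![X 0, X 1, X 2] = X := (tripEquiv (ZMod M)).left_inv X
    show ind (P X) = ind (P ![X 0, X 1, X 2])
    rw [this]
  rw [h1, h2, Fintype.sum_prod_type]
  unfold tripSum
  simp only [Fintype.sum_prod_type]
  rw [zmod_sum]
  refine Finset.sum_congr rfl fun i _ => ?_
  rw [zmod_sum]
  refine Finset.sum_congr rfl fun j _ => ?_
  rw [zmod_sum]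

lemma card_sol (A : TernMat) (hs : A.IsSymm) (M : ℕ) [NeZero M] (n : ℤ) :
    Nat.card {X : Fin 3 → ZMod M //
      (∑ i, ∑ j, X i * (A i j : ZMod M) * X j) = (n : ZMod M)} =
    solCount (tqf (A 0 0) (A 1 1) (A 2 2) (2 * A 1 2) (2 * A 0 2) (2 * A 0 1)) M n := by
  rw [card_trip]
  refine tripSum_congr M fun x y z => ind_congr ?_
  have e1 : A 1 0 = A 0 1 := hs.apply 0 1
  have e2 : A 2 0 = A 0 2 := hs.apply 0 2
  have e3 : A 2 1 = A 1 2 := hs.apply 1 2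
  rw [← ZMod.intCast_zmod_eq_zero_iff_dvd]
  simp only [Fin.sum_univ_three, e1, e2, e3]
  rw [← sub_eq_zero]
  have : (x : ZMod M) = x := rfl
  apply Eq.congr_left
  simp [tqf]
  ring

lemma dens_of (A : TernMat) (n : ℤ) (v : ℝ) (s : ℕ)
    (h : ∀ r : ℕ, (Nat.card {X : Fin 3 → ZMod (2 ^ (r + s)) //
        (∑ i, ∑ j, X i * (A i j : ZMod (2 ^ (r + s))) * X j) = (n : ZMod (2 ^ (r + s)))} : ℝ) /
          4 ^ (r + s) = v) :
    localDensity 2 Nat.prime_two n A = v := by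
  unfold localDensity
  apply Tendsto.limUnder_eq
  rw [← tendsto_add_atTop_iff_nat s]
  refine tendsto_const_nhds.congr ?_
  intro r
  rw [← h r, pow_mul]
  norm_num

lemma dens_odd (A : TernMat) (hs : A.IsSymm) (n : ℤ) (v : ℝ) (s : ℕ)
    (h : ∀ r : ℕ, (solCount (tqf (A 0 0) (A 1 1) (A 2 2) (2 * A 1 2) (2 * A 0 2) (2 * A 0 1))
      (2 ^ (r + s)) n : ℝ) / 4 ^ (r + s) = v) :
    localDensity 2 Nat.prime_two n A = v := by
  refine dens_of A n v s fun r => ?_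
  rw [card_sol A hs, h]

lemma sol_double (a b c d e f : ℤ) (M : ℕ) (m : ℤ) :
    solCount (tqf (2 * a) (2 * b) (2 * c) (2 * d) (2 * e) (2 * f)) (2 * M) (2 * m) =
      8 * solCount (tqf a b c d e f) M m := by
  unfold solCount
  rw [← tripSum_two _ _ (sol_per a b c d e f M m)]
  refine tripSum_congr _ fun x y z => ind_congr ?_
  have : tqf (2 * a) (2 * b) (2 * c) (2 * d) (2 * e) (2 * f) x y z - 2 * m =
    2 * (tqf a b c d e f x y z - m) := by
    unfold tqf
    ring
  rw [this]
  push_cast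
  exact mul_dvd_mul_iff_left two_ne_zero

lemma sol_double_odd (a b c d e f : ℤ) (M : ℕ) (n : ℤ) (hn : ¬ 2 ∣ n) :
    solCount (tqf (2 * a) (2 * b) (2 * c) (2 * d) (2 * e) (2 * f)) (2 * M) n = 0 := by
  unfold solCount tripSum
  refine Finset.sum_eq_zero fun x _ => Finset.sum_eq_zero fun y _ => Finset.sum_eq_zero fun z _ => ?_
  apply ind_neg
  rintro ⟨t, ht⟩
  apply hn
  refine ⟨tqf a b c d e f x y z - M * t, ?_⟩
  have : tqf (2 * a) (2 * b) (2 * c) (2 * d) (2 * e) (2 * f) x y z = 2 * tqf a b c d e f x y z := by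
    unfold tqf
    ring
  rw [this] at ht
  push_cast at ht
  linarith

lemma dens_even_two (A : TernMat) (hs : A.IsSymm) (a b c : ℤ) (ha : A 0 0 = 2 * a)
    (hb : A 1 1 = 2 * b) (hc : A 2 2 = 2 * c) (m : ℤ) (v : ℝ) (s : ℕ)
    (h : ∀ r : ℕ, (solCount (tqf a b c (A 1 2) (A 0 2) (A 0 1))
      (2 ^ (r + s)) m : ℝ) / 4 ^ (r + s) = v) :
    localDensity 2 Nat.prime_two (2 * m : ℤ) A = 2 * v := by
  refine dens_odd A hs _ _ (s + 1) fun r => ?_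
  have e : 2 ^ (r + (s + 1)) = 2 * 2 ^ (r + s) := by ring
  rw [e, ha, hb, hc, sol_double, ← h r, ← add_assoc, pow_succ]
  push_cast
  ring

lemma dens_even_odd (A : TernMat) (hs : A.IsSymm) (a b c : ℤ) (ha : A 0 0 = 2 * a)
    (hb : A 1 1 = 2 * b) (hc : A 2 2 = 2 * c) (n : ℤ) (hn : ¬ 2 ∣ n) :
    localDensity 2 Nat.prime_two n A = 0 := by
  refine dens_odd A hs _ _ 1 fun r => ?_
  rw [pow_succ', ha, hb, hc, sol_double_odd _ _ _ _ _ _ _ _ hn]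
  simp

lemma quadVal_eq {R : Type*} [CommRing R] (M : Matrix (Fin 3) (Fin 3) R) (h : M.IsSymm)
    (x : Fin 3 → R) : quadVal M x = M 0 0 * x 0 ^ 2 + M 1 1 * x 1 ^ 2 + M 2 2 * x 2 ^ 2 +
      2 * M 1 2 * (x 1 * x 2) + 2 * M 0 2 * (x 0 * x 2) + 2 * M 0 1 * (x 0 * x 1) := by
  have e1 : M 1 0 = M 0 1 := h.apply 0 1
  have e2 : M 2 0 = M 0 2 := h.apply 0 2
  have e3 : M 2 1 = M 1 2 := h.apply 1 2
  simp only [quadVal, Fin.sum_univ_three, e1, e2, e3]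
  ring

lemma det_eq (A : TernMat) (h : A.IsSymm) : A.det = A 0 0 * A 1 1 * A 2 2 +
    2 * A 1 2 * A 0 2 * A 0 1 - A 0 0 * A 1 2 ^ 2 - A 1 1 * A 0 2 ^ 2 - A 2 2 * A 0 1 ^ 2 := by
  have e1 : A 1 0 = A 0 1 := h.apply 0 1
  have e2 : A 2 0 = A 0 2 := h.apply 0 2
  have e3 : A 2 1 = A 1 2 := h.apply 1 2
  rw [Matrix.det_fin_three, e1, e2, e3]
  ring

lemma lat_det_ne (A : TernMat) (hA : IsLat A) : A.det ≠ 0 := by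
  intro h0
  obtain ⟨v, hv, hAv⟩ := Matrix.exists_mulVec_eq_zero_iff.2 h0
  have h := hA.2 v hv
  have : quadVal A v = v ⬝ᵥ (A *ᵥ v) := by
    simp [quadVal, dotProduct, mulVec, Fin.sum_univ_three]
    ring
  rw [this, hAv] at h
  simp at h

lemma even_diag (A : TernMat) (h : IsEvenLat A) (i : Fin 3) : 2 ∣ A i i := by
  have := h (Pi.single i 1)
  have e : quadVal A (Pi.single i 1) = A i i := by
    simp [quadVal, Pi.single_apply]
  rwa [e] at this

lemma odd_diag (A : TernMat) (hs : A.IsSymm) (h : ¬ IsEvenLat A) :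
    ¬ 2 ∣ A 0 0 ∨ ¬ 2 ∣ A 1 1 ∨ ¬ 2 ∣ A 2 2 := by
  by_contra hc
  push Not at hc
  obtain ⟨⟨a, ha⟩, ⟨b, hb⟩, ⟨c, hc⟩⟩ := hc
  apply h
  intro x
  rw [quadVal_eq A hs, ha, hb, hc]
  exact ⟨a * x 0 ^ 2 + b * x 1 ^ 2 + c * x 2 ^ 2 + A 1 2 * (x 1 * x 2) + A 0 2 * (x 0 * x 2) +
    A 0 1 * (x 0 * x 1), by ring⟩

lemma stable_odd (A : TernMat) (hA : IsLat A) (hst : StableAt A 2) (h : ¬ IsEvenLat A) :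
    ¬ 2 ∣ A.det := by
  have h1 : padicValInt 2 A.det ≠ 1 := fun h1 => h ((hst.2 rfl).1 h1)
  have h0 : padicValInt 2 A.det = 0 := by
    have := hst.1
    omega
  intro hd
  have := (padicValInt_dvd_iff (p := 2) 1 A.det).1 (by simpa using hd)
  rcases this with h2 | h2
  · exact lat_det_ne A hA h2
  · omega

lemma stable_even (A : TernMat) (hA : IsLat A) (hst : StableAt A 2) (h : IsEvenLat A) :
    ¬ 4 ∣ A.det := by
  have h1 : padicValInt 2 A.det = 1 := (hst.2 rfl).2 h
  intro hd
  have := (padicValInt_dvd_iff (p := 2) 2 A.det).1 (by simpa using hd)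
  rcases this with h2 | h2
  · exact lat_det_ne A hA h2
  · omega

lemma even_of_odd_mul {D x : ℤ} (hD : ¬ 2 ∣ D) (h : 2 ∣ D * x) : 2 ∣ x :=
  (Int.prime_two.dvd_mul.1 h).resolve_left hD

lemma allEven_odd (a b c d e f x y z : ℤ)
    (hD : ¬ 2 ∣ a * b * c + 2 * d * e * f - a * d ^ 2 - b * e ^ 2 - c * f ^ 2)
    (h1 : 2 ∣ a * x + f * y + e * z) (h2 : 2 ∣ f * x + b * y + d * z)
    (h3 : 2 ∣ e * x + d * y + c * z) : AllEven x y z := by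
  obtain ⟨r, hr⟩ := h1
  obtain ⟨s, hs⟩ := h2
  obtain ⟨t, ht⟩ := h3
  refine ⟨even_of_odd_mul hD ⟨(b * c - d ^ 2) * r + (d * e - f * c) * s + (f * d - b * e) * t, ?_⟩,
    even_of_odd_mul hD ⟨(d * e - f * c) * r + (a * c - e ^ 2) * s + (e * f - a * d) * t, ?_⟩,
    even_of_odd_mul hD ⟨(f * d - b * e) * r + (e * f - a * d) * s + (a * b - f ^ 2) * t, ?_⟩⟩
  · linear_combination (b * c - d ^ 2) * hr + (d * e - f * c) * hs + (f * d - b * e) * ht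
  · linear_combination (d * e - f * c) * hr + (a * c - e ^ 2) * hs + (e * f - a * d) * ht
  · linear_combination (f * d - b * e) * hr + (e * f - a * d) * hs + (a * b - f ^ 2) * ht

lemma grad_odd (a b c d e f : ℤ)
    (hD : ¬ 2 ∣ a * b * c + 2 * d * e * f - a * d ^ 2 - b * e ^ 2 - c * f ^ 2) :
    GradCond a b c (2 * d) (2 * e) (2 * f) := by
  intro x y z h1 h2 h3
  refine allEven_odd a b c d e f x y z hD ?_ ?_ ?_
  · obtain ⟨t, ht⟩ := h1
    exact ⟨t, by linarith⟩
  · obtain ⟨t, ht⟩ := h2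
    exact ⟨t, by linarith⟩
  · obtain ⟨t, ht⟩ := h3
    exact ⟨t, by linarith⟩

lemma grad_even (a b c d e f : ℤ)
    (hD : ¬ 2 ∣ 4 * a * b * c + d * e * f - a * d ^ 2 - b * e ^ 2 - c * f ^ 2) :
    GradCond a b c d e f := by
  intro x y z h1 h2 h3
  obtain ⟨r, hr⟩ := h1
  obtain ⟨s, hs⟩ := h2
  obtain ⟨t, ht⟩ := h3
  refine ⟨even_of_odd_mul hD ⟨(4 * b * c - d ^ 2) * r + (d * e - 2 * f * c) * s
      + (f * d - 2 * b * e) * t, ?_⟩,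
    even_of_odd_mul hD ⟨(d * e - 2 * f * c) * r + (4 * a * c - e ^ 2) * s
      + (e * f - 2 * a * d) * t, ?_⟩,
    even_of_odd_mul hD ⟨(f * d - 2 * b * e) * r + (e * f - 2 * a * d) * s
      + (4 * a * b - f ^ 2) * t, ?_⟩⟩
  · apply mul_left_cancel₀ (two_ne_zero (α := ℤ))
    linear_combination (4 * b * c - d ^ 2) * hr + (d * e - 2 * f * c) * hs + (f * d - 2 * b * e) * ht
  · apply mul_left_cancel₀ (two_ne_zero (α := ℤ))
    linear_combination (d * e - 2 * f * c) * hr + (4 * a * c - e ^ 2) * hs + (e * f - 2 * a * d) * ht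
  · apply mul_left_cancel₀ (two_ne_zero (α := ℤ))
    linear_combination (f * d - 2 * b * e) * hr + (e * f - 2 * a * d) * hs + (4 * a * b - f ^ 2) * ht

lemma tripSum_ne_zero (M : ℕ) (f : ℤ → ℤ → ℤ → ℕ) :
    tripSum M f ≠ 0 ↔ ∃ x y z : ℕ, x < M ∧ y < M ∧ z < M ∧ f x y z ≠ 0 := by
  unfold tripSum
  constructor
  · intro h
    obtain ⟨x, hx, h⟩ := Finset.exists_ne_zero_of_sum_ne_zero h
    obtain ⟨y, hy, h⟩ := Finset.exists_ne_zero_of_sum_ne_zero h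
    obtain ⟨z, hz, h⟩ := Finset.exists_ne_zero_of_sum_ne_zero h
    exact ⟨x, y, z, Finset.mem_range.1 hx, Finset.mem_range.1 hy, Finset.mem_range.1 hz, h⟩
  · rintro ⟨x, y, z, hx, hy, hz, h⟩ h0
    rw [Finset.sum_eq_zero_iff] at h0
    have h0 := h0 x (Finset.mem_range.2 hx)
    rw [Finset.sum_eq_zero_iff] at h0
    have h0 := h0 y (Finset.mem_range.2 hy)
    rw [Finset.sum_eq_zero_iff] at h0
    exact h (h0 z (Finset.mem_range.2 hz))

lemma ind_ne_zero {P : Prop} : ind P ≠ 0 ↔ P := by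
  by_cases h : P
  · rw [ind_pos h]
    simpa using h
  · rw [ind_neg h]
    simpa using h

lemma padicMat_symm (A : TernMat) (h : A.IsSymm) : (padicMat 2 A).IsSymm := h.map _

lemma padic_descent (B : Matrix (Fin 3) (Fin 3) ℤ_[2]) (k : ℕ) : ∀ (x : Fin 3 → ℤ_[2]) (i : Fin 3),
    ¬ (2 : ℤ_[2]) ^ k ∣ x i → quadVal B x = 0 →
    ∃ y : Fin 3 → ℤ_[2], (∃ j, ¬ 2 ∣ y j) ∧ quadVal B y = 0 := by
  induction k with
  | zero =>
    intro x i h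
    simp at h
  | succ k ih =>
    intro x i h hq
    by_cases hall : ∀ j, (2 : ℤ_[2]) ∣ x j
    · choose y hy using hall
      refine ih y i ?_ ?_
      · intro hd
        apply h
        rw [hy i, pow_succ']
        exact mul_dvd_mul_left 2 hd
      · have : quadVal B x = 4 * quadVal B y := by
          simp only [quadVal, Finset.mul_sum, hy]
          refine Finset.sum_congr rfl fun i _ => Finset.sum_congr rfl fun j _ => ?_
          ring
        rw [this] at hq
        exact (mul_eq_zero.1 hq).resolve_left (by exact_mod_cast (by norm_num : (4 : ℕ) ≠ 0))
    · push Not at hall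
      exact ⟨x, hall, hq⟩

lemma padic_not_dvd (x : ℤ_[2]) (hx : x ≠ 0) : ∃ k : ℕ, ¬ (2 : ℤ_[2]) ^ k ∣ x := by
  by_contra hc
  push Not at hc
  apply hx
  rw [← PadicInt.ext_of_toZModPow]
  intro n
  rw [map_zero]
  have : x ∈ RingHom.ker (PadicInt.toZModPow (p := 2) n) := by
    rw [PadicInt.ker_toZModPow, Ideal.mem_span_singleton]
    exact_mod_cast hc n
  exact this

lemma padic_appr (x : ℤ_[2]) : ∃ u : ℕ, u < 8 ∧ PadicInt.toZModPow (p := 2) 3 x = (u : ZMod (2 ^ 3)) ∧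
    (¬ 2 ∣ x → ¬ (2 : ℤ) ∣ u) := by
  have h := PadicInt.appr_spec (p := 2) 3 x
  refine ⟨x.appr 3, by simpa using PadicInt.appr_lt x 3, ?_, ?_⟩
  · rw [← PadicInt.ker_toZModPow, RingHom.mem_ker, map_sub, map_natCast, sub_eq_zero] at h
    exact h
  · intro hx hu
    apply hx
    rw [Ideal.mem_span_singleton] at h
    obtain ⟨t, ht⟩ := h
    obtain ⟨s, hs⟩ := hu
    have hs' : ((x.appr 3 : ℕ) : ℤ_[2]) = 2 * (s : ℤ_[2]) := by exact_mod_cast congrArg (Int.cast : ℤ → ℤ_[2]) hs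
    rw [hs'] at ht
    push_cast at ht
    exact ⟨s + 4 * t, by linear_combination ht⟩

lemma iso_prim (A : TernMat) (hs : A.IsSymm) (h : IsotropicP 2 A) :
    pc (A 0 0) (A 1 1) (A 2 2) (2 * A 1 2) (2 * A 0 2) (2 * A 0 1) 0 ≠ 0 := by
  obtain ⟨x, hx, hq⟩ := h
  obtain ⟨i, hi⟩ := Function.ne_iff.1 hx
  obtain ⟨k, hk⟩ := padic_not_dvd (x i) hi
  obtain ⟨y, ⟨j, hj⟩, hy⟩ := padic_descent _ k x i hk hq
  choose u hu1 hu2 hu3 using fun i => padic_appr (y i)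
  unfold pc primCount
  rw [tripSum_ne_zero]
  refine ⟨u 0, u 1, u 2, hu1 0, hu1 1, hu1 2, ?_⟩
  rw [ind_ne_zero]
  constructor
  · rintro ⟨h0, h1, h2⟩
    have := hu3 j hj
    fin_cases j
    · exact this h0
    · exact this h1
    · exact this h2
  · rw [quadVal_eq _ (padicMat_symm A hs)] at hy
    have := congrArg (PadicInt.toZModPow (p := 2) 3) hy
    simp only [padicMat, Matrix.map_apply, map_add, map_mul, map_pow, map_intCast, map_ofNat, map_zero, hu2] at this
    have h8 : ((8 : ℕ) : ℤ) = ((2 ^ 3 : ℕ) : ℤ) := by norm_num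
    rw [h8, ← ZMod.intCast_zmod_eq_zero_iff_dvd, ← this]
    simp [tqf]
    ring

lemma hensel_quad (p q r : ℤ) (hp : 8 ∣ p) (hq : ¬ 2 ∣ q) :
    ∃ t : ℤ_[2], (p : ℤ_[2]) + 2 * q * t + r * t ^ 2 = 0 ∧ 2 ∣ t := by
  let F : Polynomial ℤ_[2] := Polynomial.C (p : ℤ_[2]) + Polynomial.C (2 * q : ℤ_[2]) * Polynomial.X +
    Polynomial.C (r : ℤ_[2]) * Polynomial.X ^ 2
  have hF : ∀ t : ℤ_[2], F.aeval t = (p : ℤ_[2]) + 2 * q * t + r * t ^ 2 := by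
    intro t
    simp [F]
  have hF' : F.derivative.aeval (0 : ℤ_[2]) = 2 * (q : ℤ_[2]) := by
    simp [F]
  have hnq : ‖(2 * (q : ℤ_[2]))‖ = 1 / 2 := by
    rw [norm_mul]
    have h1 : ‖(q : ℤ_[2])‖ = 1 := by
      have h1 := PadicInt.norm_le_one (q : ℤ_[2])
      have h2 : ¬ ‖(q : ℤ_[2])‖ < 1 := by
        rw [PadicInt.norm_int_lt_one_iff_dvd]
        exact hq
      linarith [not_lt.1 h2]
    have h2 : ‖(2 : ℤ_[2])‖ = 1 / 2 := by
      have := PadicInt.norm_p (p := 2)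
      simpa using this
    rw [h1, h2]
    norm_num
  have hnp : ‖(p : ℤ_[2])‖ ≤ 1 / 8 := by
    have := (PadicInt.norm_int_le_pow_iff_dvd (p := 2) (k := p) (n := 3)).2 (by simpa using hp)
    refine this.trans (le_of_eq ?_)
    norm_num
  have hnorm : ‖F.aeval (0 : ℤ_[2])‖ < ‖F.derivative.aeval (0 : ℤ_[2])‖ ^ 2 := by
    rw [hF, hF', hnq]
    simp only [mul_zero, add_zero, ne_eq, OfNat.ofNat_ne_zero, not_false_eq_true, zero_pow]
    refine lt_of_le_of_lt hnp ?_
    norm_num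
  obtain ⟨t, ht, ht2, -⟩ := hensels_lemma hnorm
  refine ⟨t, by rw [← hF, ht], ?_⟩
  rw [hF', hnq, sub_zero] at ht2
  have h3 : ‖t‖ < 1 := by linarith
  have := PadicInt.norm_lt_one_iff_dvd t
  exact_mod_cast this.1 h3

lemma padic_odd (x : ℤ) (hx : ¬ 2 ∣ x) (s : ℤ_[2]) (hs : 2 ∣ s) : (x : ℤ_[2]) + s ≠ 0 := by
  intro h
  apply hx
  have h2 : (2 : ℤ_[2]) ∣ (x : ℤ_[2]) := by
    have : (x : ℤ_[2]) = -s := by linear_combination h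
    rw [this]
    exact (dvd_neg).2 hs
  have := (PadicInt.norm_lt_one_iff_dvd (p := 2) (x : ℤ_[2])).2 (by exact_mod_cast h2)
  exact_mod_cast (PadicInt.norm_int_lt_one_iff_dvd (p := 2) x).1 this

lemma prim_iso (A : TernMat) (hs : A.IsSymm) (hD : ¬ 2 ∣ A.det)
    (h : pc (A 0 0) (A 1 1) (A 2 2) (2 * A 1 2) (2 * A 0 2) (2 * A 0 1) 0 ≠ 0) :
    IsotropicP 2 A := by
  unfold pc primCount at h
  rw [tripSum_ne_zero] at h
  obtain ⟨x, y, z, -, -, -, h⟩ := h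
  rw [ind_ne_zero] at h
  obtain ⟨hpr, hq⟩ := h
  generalize (x : ℤ) = x at hpr hq
  generalize (y : ℤ) = y at hpr hq
  generalize (z : ℤ) = z at hpr hq
  rw [sub_zero] at hq
  rw [det_eq A hs] at hD
  have key : ∀ s1 s2 s3 : ℤ_[2], 2 ∣ s1 → 2 ∣ s2 → 2 ∣ s3 →
      quadVal (padicMat 2 A) ![(x : ℤ_[2]) + s1, (y : ℤ_[2]) + s2, (z : ℤ_[2]) + s3] = 0 →
      IsotropicP 2 A := by
    intro s1 s2 s3 h1 h2 h3 hQ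
    refine ⟨_, ?_, hQ⟩
    intro h0
    have e0 : (x : ℤ_[2]) + s1 = 0 := congrFun h0 0
    have e1 : (y : ℤ_[2]) + s2 = 0 := congrFun h0 1
    have e2 : (z : ℤ_[2]) + s3 = 0 := congrFun h0 2
    apply hpr
    refine ⟨?_, ?_, ?_⟩
    · by_contra hx
      exact padic_odd x hx s1 h1 e0
    · by_contra hx
      exact padic_odd y hx s2 h2 e1
    · by_contra hx
      exact padic_odd z hx s3 h3 e2
  by_cases g1 : 2 ∣ A 0 0 * x + A 0 1 * y + A 0 2 * z
  · by_cases g2 : 2 ∣ A 0 1 * x + A 1 1 * y + A 1 2 * z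
    · by_cases g3 : 2 ∣ A 0 2 * x + A 1 2 * y + A 2 2 * z
      · exact absurd (allEven_odd _ _ _ _ _ _ x y z hD g1 g2 g3) hpr
      · obtain ⟨t, ht, ht2⟩ := hensel_quad _ _ (A 2 2) hq g3
        refine key 0 0 t (dvd_zero _) (dvd_zero _) ht2 ?_
        rw [quadVal_eq _ (padicMat_symm A hs)]
        refine Eq.trans ?_ ht
        simp only [padicMat, Matrix.map_apply, tqf, Matrix.cons_val_zero, Matrix.cons_val_one, Matrix.cons_val]
        push_cast
        ring
    · obtain ⟨t, ht, ht2⟩ := hensel_quad _ _ (A 1 1) hq g2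
      refine key 0 t 0 (dvd_zero _) ht2 (dvd_zero _) ?_
      rw [quadVal_eq _ (padicMat_symm A hs)]
      refine Eq.trans ?_ ht
      simp only [padicMat, Matrix.map_apply, tqf, Matrix.cons_val_zero, Matrix.cons_val_one, Matrix.cons_val]
      push_cast
      ring
  · obtain ⟨t, ht, ht2⟩ := hensel_quad _ _ (A 0 0) hq g1
    refine key t 0 0 ht2 (dvd_zero _) (dvd_zero _) ?_
    rw [quadVal_eq _ (padicMat_symm A hs)]
    refine Eq.trans ?_ ht
    simp only [padicMat, Matrix.map_apply, tqf, Matrix.cons_val_zero, Matrix.cons_val_one, Matrix.cons_val]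
    push_cast
    ring

/-- The counts modulo eight attached to a Gram matrix. -/
noncomputable def oddP (A : TernMat) : ℤ → ℕ :=
  pc (A 0 0) (A 1 1) (A 2 2) (2 * A 1 2) (2 * A 0 2) (2 * A 0 1)

lemma oddP_congr (A : TernMat) (n m : ℤ) (h : 8 ∣ n - m) : oddP A n = oddP A m :=
  primCount_congr _ 8 n m h

lemma odd_value (A : TernMat) (hs : A.IsSymm) (hD : ¬ 2 ∣ A.det) (C : ℕ) (h0 : oddP A 0 = C)
    (h4 : oddP A 4 = C) (m : ℤ) (hm : ¬ 4 ∣ m) (k : ℕ) :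
    localDensity 2 Nat.prime_two (4 ^ k * m) A =
      C / 32 + ((oddP A m : ℝ) / 64 - C / 32) * ((2 : ℝ) ^ k)⁻¹ := by
  rw [det_eq A hs] at hD
  refine dens_odd A hs _ _ (3 + 2 * k) fun r => ?_
  rw [← add_assoc]
  exact sol_formula _ _ _ _ _ _ (grad_odd _ _ _ _ _ _ hD) C h0 h4 m hm k r

lemma even_value (A : TernMat) (hs : A.IsSymm) (a b c : ℤ) (ha : A 0 0 = 2 * a)
    (hb : A 1 1 = 2 * b) (hc : A 2 2 = 2 * c)
    (hD : ¬ 2 ∣ 4 * a * b * c + A 1 2 * A 0 2 * A 0 1 - a * A 1 2 ^ 2 - b * A 0 2 ^ 2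
      - c * A 0 1 ^ 2) (C : ℕ)
    (h0 : pc a b c (A 1 2) (A 0 2) (A 0 1) 0 = C) (h4 : pc a b c (A 1 2) (A 0 2) (A 0 1) 4 = C)
    (m : ℤ) (hm : ¬ 4 ∣ m) (k : ℕ) :
    localDensity 2 Nat.prime_two (2 * (4 ^ k * m)) A =
      2 * (C / 32 + ((pc a b c (A 1 2) (A 0 2) (A 0 1) m : ℝ) / 64 - C / 32) * ((2 : ℝ) ^ k)⁻¹) := by
  refine dens_even_two A hs a b c ha hb hc _ _ (3 + 2 * k) fun r => ?_
  rw [← add_assoc]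
  exact sol_formula _ _ _ _ _ _ (grad_even _ _ _ _ _ _ hD) C h0 h4 m hm k r

lemma oddTab_of (A : TernMat) (hs : A.IsSymm) (hD : ¬ 2 ∣ A.det) (hev : ¬ IsEvenLat A) :
    OddTab (oddP A) A.det := by
  have hD' := hD
  rw [det_eq A hs] at hD' ⊢
  exact oddTab_main _ _ _ _ _ _ (odd_diag A hs hev) hD'

lemma val_mod4 (P : ℤ → ℕ) (hP : ∀ n m, 8 ∣ n - m → P n = P m) (D : ℤ) (v : ℕ) (h1 : P D = v)
    (h2 : P (D + 4) = v) (b : ℤ) (hb : b % 4 = D % 4) : P b = v := by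
  have : 8 ∣ b - D ∨ 8 ∣ b - (D + 4) := by omega
  rcases this with h | h
  · rw [hP _ _ h, h1]
  · rw [hP _ _ h, h2]

lemma val_two (P : ℤ → ℕ) (hP : ∀ n m, 8 ∣ n - m → P n = P m) (v : ℕ) (h1 : P 2 = v)
    (h2 : P 6 = v) (b : ℤ) (hb : ¬ 2 ∣ b) : P (2 * b) = v := by
  have : 8 ∣ 2 * b - 2 ∨ 8 ∣ 2 * b - 6 := by omega
  rcases this with h | h
  · rw [hP _ _ h, h1]
  · rw [hP _ _ h, h2]

lemma cast_even (β k : ℕ) : ((β * 2 ^ (k + k) : ℕ) : ℤ) = 4 ^ k * (β : ℤ) := by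
  push_cast
  rw [← two_mul, pow_mul]
  norm_num
  ring

lemma cast_odd (β k : ℕ) : ((β * 2 ^ (2 * k + 1) : ℕ) : ℤ) = 4 ^ k * (2 * (β : ℤ)) := by
  push_cast
  rw [pow_succ, pow_mul]
  norm_num
  ring

lemma odd_part (A : TernMat) (hA : IsLat A) (hst : StableAt A 2) (β a : ℕ) (hβ : Odd β)
    (hev : ¬ IsEvenLat A) (C v2 v1 v3 v7 : ℕ)
    (h0 : oddP A 0 = C) (h4 : oddP A 4 = C) (h2 : oddP A 2 = v2) (h6 : oddP A 6 = v2)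
    (h1 : oddP A A.det = v1) (h5 : oddP A (A.det + 4) = v1) (h3 : oddP A (3 * A.det) = v3)
    (h7 : oddP A (7 * A.det) = v7) :
    (Odd a → localDensity 2 Nat.prime_two ((β * 2 ^ a : ℕ) : ℤ) A =
      C / 32 + 2 * ((v2 : ℝ) / 64 - C / 32) * ((2 : ℝ) ^ ((a + 1) / 2))⁻¹) ∧
    (Even a → (β : ℤ) % 4 = A.det % 4 → localDensity 2 Nat.prime_two ((β * 2 ^ a : ℕ) : ℤ) A =
      C / 32 + 2 * ((v1 : ℝ) / 64 - C / 32) * ((2 : ℝ) ^ ((a + 2) / 2))⁻¹) ∧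
    (Even a → (β : ℤ) % 8 = 3 * A.det % 8 → localDensity 2 Nat.prime_two ((β * 2 ^ a : ℕ) : ℤ) A =
      C / 32 + ((v3 : ℝ) / 64 - C / 32) * ((2 : ℝ) ^ (a / 2))⁻¹) ∧
    (Even a → (β : ℤ) % 8 = 7 * A.det % 8 → localDensity 2 Nat.prime_two ((β * 2 ^ a : ℕ) : ℤ) A =
      C / 32 + ((v7 : ℝ) / 64 - C / 32) * ((2 : ℝ) ^ (a / 2))⁻¹) := by
  have hD := stable_odd A hA hst hev
  have hb : ¬ (2 : ℤ) ∣ (β : ℤ) := by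
    obtain ⟨t, ht⟩ := hβ
    omega
  refine ⟨?_, ?_, ?_, ?_⟩
  · rintro ⟨k, rfl⟩
    rw [cast_odd, odd_value A hA.1 hD C h0 h4 _ (by omega), val_two _ (oddP_congr A) v2 h2 h6 _ hb]
    have : (2 * k + 1 + 1) / 2 = k + 1 := by omega
    rw [this, pow_succ, mul_inv]
    ring
  · rintro ⟨k, rfl⟩ hm
    rw [cast_even, odd_value A hA.1 hD C h0 h4 _ (by omega),
      val_mod4 _ (oddP_congr A) A.det v1 h1 h5 _ hm]
    have : (k + k + 2) / 2 = k + 1 := by omega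
    rw [this, pow_succ, mul_inv]
    ring
  · rintro ⟨k, rfl⟩ hm
    rw [cast_even, odd_value A hA.1 hD C h0 h4 _ (by omega),
      oddP_congr A _ (3 * A.det) (by omega), h3]
    have : (k + k) / 2 = k := by omega
    rw [this]
  · rintro ⟨k, rfl⟩ hm
    rw [cast_even, odd_value A hA.1 hD C h0 h4 _ (by omega),
      oddP_congr A _ (7 * A.det) (by omega), h7]
    have : (k + k) / 2 = k := by omega
    rw [this]

lemma even_part (A : TernMat) (hA : IsLat A) (hst : StableAt A 2) (β a : ℕ) (hβ : Odd β)
    (hev : IsEvenLat A) :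
    (Even a → localDensity 2 Nat.prime_two ((β * 2 ^ a : ℕ) : ℤ) A =
      3 - 3 * ((2 : ℝ) ^ (a / 2))⁻¹) ∧
    (Odd a → (β : ℤ) % 4 = A.det / 2 % 4 →
      localDensity 2 Nat.prime_two ((β * 2 ^ a : ℕ) : ℤ) A = 3 - 3 * ((2 : ℝ) ^ ((a + 1) / 2))⁻¹) ∧
    (Odd a → (β : ℤ) % 8 = 3 * (A.det / 2) % 8 →
      localDensity 2 Nat.prime_two ((β * 2 ^ a : ℕ) : ℤ) A = 3 - ((2 : ℝ) ^ ((a - 1) / 2))⁻¹) ∧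
    (Odd a → (β : ℤ) % 8 = 7 * (A.det / 2) % 8 →
      localDensity 2 Nat.prime_two ((β * 2 ^ a : ℕ) : ℤ) A = 3) := by
  have hb : ¬ (2 : ℤ) ∣ (β : ℤ) := by
    obtain ⟨t, ht⟩ := hβ
    omega
  have hs := hA.1
  have hd := stable_even A hA hst hev
  obtain ⟨x, hx⟩ := even_diag A hev 0
  obtain ⟨y, hy⟩ := even_diag A hev 1
  obtain ⟨z, hz⟩ := even_diag A hev 2
  obtain ⟨D, hDdef⟩ : ∃ D, D = 4 * x * y * z + A 1 2 * A 0 2 * A 0 1 - x * A 1 2 ^ 2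
      - y * A 0 2 ^ 2 - z * A 0 1 ^ 2 := ⟨_, rfl⟩
  have hdet : A.det = 2 * D := by
    rw [det_eq A hs, hx, hy, hz, hDdef]
    ring
  have hD2 : ¬ 2 ∣ D := by
    intro h
    apply hd
    rw [hdet]
    omega
  have hdiv : A.det / 2 = D := by omega
  rw [hdiv]
  have hD := hD2
  rw [hDdef] at hD
  have tab := evenTab_main x y z (A 1 2) (A 0 2) (A 0 1) hD
  rw [← hDdef] at tab
  have hP : ∀ n m, 8 ∣ n - m → pc x y z (A 1 2) (A 0 2) (A 0 1) n = pc x y z (A 1 2) (A 0 2) (A 0 1) m :=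
    fun n m h => primCount_congr _ 8 n m h
  obtain ⟨h0, h4, h2, h6, h1, h5, h3, h7⟩ := tab
  have hval := even_value A hs x y z hx hy hz hD 48 h0 h4
  have hco : ∀ k : ℕ, ((β * 2 ^ (2 * k + 1) : ℕ) : ℤ) = 2 * (4 ^ k * (β : ℤ)) := by
    intro k
    rw [cast_odd]
    ring
  refine ⟨?_, ?_, ?_, ?_⟩
  · rintro ⟨k, rfl⟩
    rcases k with _ | k
    · rw [dens_even_odd A hs x y z hx hy hz _ (by simpa using hb)]
      norm_num
    · have e : ((β * 2 ^ (k + 1 + (k + 1)) : ℕ) : ℤ) = 2 * (4 ^ k * (2 * (β : ℤ))) := by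
        rw [cast_even]
        ring
      rw [e, hval _ (by omega), val_two _ hP 48 h2 h6 _ hb]
      have : (k + 1 + (k + 1)) / 2 = k + 1 := by omega
      rw [this, pow_succ, mul_inv]
      push_cast
      ring
  · rintro ⟨k, rfl⟩ hm
    rw [hco, hval _ (by omega), val_mod4 _ hP D 48 h1 h5 _ hm]
    have : (2 * k + 1 + 1) / 2 = k + 1 := by omega
    rw [this, pow_succ, mul_inv]
    push_cast
    ring
  · rintro ⟨k, rfl⟩ hm
    rw [hco, hval _ (by omega), hP _ (3 * D) (by omega), h3]
    have : (2 * k + 1 - 1) / 2 = k := by omega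
    rw [this]
    push_cast
    ring
  · rintro ⟨k, rfl⟩ hm
    rw [hco, hval _ (by omega), hP _ (7 * D) (by omega), h7]
    push_cast
    ring

/-- Local densities at `2` of a ternary lattice stable at `2`,
for `n = β·2^a` with `β` odd. -/
theorem localDensity_stable_two (A : TernMat) (hA : IsLat A) (hprim : IsPrimitiveLat A)
    (hst : StableAt A 2) (n β a : ℕ) (hβ : Odd β) (hn : n = β * 2 ^ a) :
    (¬IsEvenLat A → ¬IsotropicP 2 A →
      (Odd a → localDensity 2 Nat.prime_two n A = 3 * ((2 : ℝ) ^ ((a + 1) / 2))⁻¹) ∧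
      (Even a → (β : ℤ) % 4 = A.det % 4 →
        localDensity 2 Nat.prime_two n A = 3 * ((2 : ℝ) ^ ((a + 2) / 2))⁻¹) ∧
      (Even a → (β : ℤ) % 8 = 3 * A.det % 8 →
        localDensity 2 Nat.prime_two n A = ((2 : ℝ) ^ (a / 2))⁻¹) ∧
      (Even a → (β : ℤ) % 8 = 7 * A.det % 8 →
        localDensity 2 Nat.prime_two n A = 0)) ∧
    (¬IsEvenLat A → IsotropicP 2 A →
      (Odd a → localDensity 2 Nat.prime_two n A = 2 - 3 * ((2 : ℝ) ^ ((a + 1) / 2))⁻¹) ∧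
      (Even a → (β : ℤ) % 4 = A.det % 4 →
        localDensity 2 Nat.prime_two n A = 2 - 3 * ((2 : ℝ) ^ ((a + 2) / 2))⁻¹) ∧
      (Even a → (β : ℤ) % 8 = 3 * A.det % 8 →
        localDensity 2 Nat.prime_two n A = 2 - ((2 : ℝ) ^ (a / 2))⁻¹) ∧
      (Even a → (β : ℤ) % 8 = 7 * A.det % 8 →
        localDensity 2 Nat.prime_two n A = 2)) ∧
    (IsEvenLat A →
      (Even a → localDensity 2 Nat.prime_two n A = 3 - 3 * ((2 : ℝ) ^ (a / 2))⁻¹) ∧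
      (Odd a → (β : ℤ) % 4 = A.det / 2 % 4 →
        localDensity 2 Nat.prime_two n A = 3 - 3 * ((2 : ℝ) ^ ((a + 1) / 2))⁻¹) ∧
      (Odd a → (β : ℤ) % 8 = 3 * (A.det / 2) % 8 →
        localDensity 2 Nat.prime_two n A = 3 - ((2 : ℝ) ^ ((a - 1) / 2))⁻¹) ∧
      (Odd a → (β : ℤ) % 8 = 7 * (A.det / 2) % 8 →
        localDensity 2 Nat.prime_two n A = 3)) := by

  subst hn
  refine ⟨?_, ?_, fun hev => even_part A hA hst β a hβ hev⟩
  · intro hev hiso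
    have hD := stable_odd A hA hst hev
    rcases oddTab_of A hA.1 hD hev with tab | tab
    · obtain ⟨h0, h4, h2, h6, h1, h5, h3, h7⟩ := tab
      obtain ⟨q1, q2, q3, q4⟩ :=
        odd_part A hA hst β a hβ hev 0 96 96 64 0 h0 h4 h2 h6 h1 h5 h3 h7
      refine ⟨fun ha => (q1 ha).trans ?_, fun ha hm => (q2 ha hm).trans ?_,
        fun ha hm => (q3 ha hm).trans ?_, fun ha hm => (q4 ha hm).trans ?_⟩ <;> push_cast <;> ring
    · exact absurd (prim_iso A hA.1 hD (by
        have : oddP A 0 ≠ 0 := by rw [tab.1]; norm_num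
        exact this)) hiso
  · intro hev hiso
    have hD := stable_odd A hA hst hev
    rcases oddTab_of A hA.1 hD hev with tab | tab
    · exact absurd tab.1 (iso_prim A hA.1 hiso)
    · obtain ⟨h0, h4, h2, h6, h1, h5, h3, h7⟩ := tab
      obtain ⟨q1, q2, q3, q4⟩ :=
        odd_part A hA hst β a hβ hev 64 32 32 64 128 h0 h4 h2 h6 h1 h5 h3 h7
      refine ⟨fun ha => (q1 ha).trans ?_, fun ha hm => (q2 ha hm).trans ?_,
        fun ha hm => (q3 ha hm).trans ?_, fun ha hm => (q4 ha hm).trans ?_⟩ <;> push_cast <;> ring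
end

section
/- Let L be a lattice on a quadratic space V and let m be a prime or 4. Then (1) σ(Λ_m(L)) = Λ_m(σ(L)) for every σ ∈ O(V); in particular the automorph group O(L) is a subgroup of O(Λ_m(L)); and (2) Λ_m induces a surjective map from the set gen(L)/∼ of isometry classes in the genus of L onto gen(Λ_m(L))/∼. -/
open scoped BigOperators Classical
open Matrix Filter

/-! ## Lattices on a rational quadratic space -/

section QuadraticSpace

variable {V : Type*} [AddCommGroup V] [Module ℚ V]

/-- `L` is a (positive-definite, integral, full-rank) lattice on the quadratic space `(V, B)`. -/
def IsIntegralLatticeOn (B : LinearMap.BilinForm ℚ V) (L : Submodule ℤ V) : Prop :=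
  L.FG ∧ Submodule.span ℚ (L : Set V) = ⊤ ∧
    (∀ x ∈ L, ∀ y ∈ L, ∃ k : ℤ, B x y = (k : ℚ)) ∧
    ∀ x : V, x ≠ 0 → 0 < B x x

/-- `σ ∈ O(V)`: a linear automorphism preserving the bilinear form. -/
def IsIsometryOfSpace (B : LinearMap.BilinForm ℚ V) (σ : V ≃ₗ[ℚ] V) : Prop :=
  ∀ x y : V, B (σ x) (σ y) = B x y

/-- The image lattice `σ(L)`. -/
def mapLat (σ : V ≃ₗ[ℚ] V) (L : Submodule ℤ V) : Submodule ℤ V :=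
  Submodule.map (σ.toLinearMap.restrictScalars ℤ) L

/-- The underlying set of `Λ_m(L) = {x ∈ L : Q(x+y) ≡ Q(y) (mod m) for all y ∈ L}`. -/
def watsonSet (m : ℕ) (B : LinearMap.BilinForm ℚ V) (L : Submodule ℤ V) : Set V :=
  {x | x ∈ L ∧ ∀ y ∈ L, ∃ k : ℤ, B (x + y) (x + y) - B y y = (m : ℚ) * k}

/-- `G` is the Gram matrix of `L` with respect to some (ℤ-)basis of `L`. -/
def GramOf (B : LinearMap.BilinForm ℚ V) (L : Submodule ℤ V) {n : ℕ}
    (G : Matrix (Fin n) (Fin n) ℤ) : Prop :=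
  ∃ v : Fin n → V, LinearIndependent ℚ v ∧ Submodule.span ℤ (Set.range v) = L ∧
    ∀ i j, B (v i) (v j) = ((G i j : ℤ) : ℚ)

/-- `ℤ_p`-equivalence of integral Gram matrices. -/
def PadicIsomZ (p : ℕ) (hp : p.Prime) {n : ℕ} (G H : Matrix (Fin n) (Fin n) ℤ) : Prop :=
  letI : Fact p.Prime := ⟨hp⟩
  ∃ U : Matrix (Fin n) (Fin n) ℤ_[p], IsUnit U.det ∧ Uᵀ * padicMat p G * U = padicMat p H

/-- `K` belongs to the genus of `L` (as lattices on `(V, B)`): `K_p ≅ L_p` for all primes `p`. -/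
def InGenusSub (B : LinearMap.BilinForm ℚ V) (L K : Submodule ℤ V) : Prop :=
  IsIntegralLatticeOn B K ∧ ∀ (p : ℕ) (hp : p.Prime),
    ∃ (n : ℕ) (G G' : Matrix (Fin n) (Fin n) ℤ),
      GramOf B L G ∧ GramOf B K G' ∧ PadicIsomZ p hp G G'

/-- Isometry of lattices on `(V, B)`. -/
def LatIsomSub (B : LinearMap.BilinForm ℚ V) (L K : Submodule ℤ V) : Prop :=
  ∃ σ : V ≃ₗ[ℚ] V, IsIsometryOfSpace B σ ∧ mapLat σ L = K

/-- The number of automorphs `o(L)` of a lattice on `(V, B)`. -/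
noncomputable def numAutSub (B : LinearMap.BilinForm ℚ V) (L : Submodule ℤ V) : ℕ :=
  Nat.card {σ : V ≃ₗ[ℚ] V // IsIsometryOfSpace B σ ∧ mapLat σ L = L}

end QuadraticSpace
section WatsonHelpers

variable {V : Type*} [AddCommGroup V] [Module ℚ V]

/-- integral combination -/
def cb {n : ℕ} (v : Fin n → V) (c : Fin n → ℤ) : V := ∑ i, c i • v i

/-- a `ℤ`-basis of a lattice -/
def IsBas {n : ℕ} (L : Submodule ℤ V) (v : Fin n → V) : Prop :=
  LinearIndependent ℚ v ∧ Submodule.span ℤ (Set.range v) = L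

/-- Gram matrix of a family -/
def Gr {n : ℕ} (B : LinearMap.BilinForm ℚ V) (v : Fin n → V) (G : Matrix (Fin n) (Fin n) ℤ) :
    Prop := ∀ i j, B (v i) (v j) = ((G i j : ℤ) : ℚ)

theorem cb_add {n : ℕ} (v : Fin n → V) (c d : Fin n → ℤ) : cb v (c + d) = cb v c + cb v d := by
  simp [cb, add_smul, Finset.sum_add_distrib]

theorem cb_smul {n : ℕ} (v : Fin n → V) (a : ℤ) (c : Fin n → ℤ) :
    cb v (a • c) = a • cb v c := by
  simp [cb, Finset.smul_sum, mul_smul]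

theorem cb_zero {n : ℕ} (v : Fin n → V) : cb v 0 = 0 := by simp [cb]

theorem cb_single {n : ℕ} (v : Fin n → V) (i : Fin n) : cb v (Pi.single i 1) = v i := by
  simp [cb, Pi.single_apply]

theorem cb_cb {n : ℕ} (v w : Fin n → V) (M : Matrix (Fin n) (Fin n) ℤ)
    (h : ∀ j, v j = cb w (fun i => M i j)) (c : Fin n → ℤ) : cb v c = cb w (M *ᵥ c) := by
  simp only [cb] at h
  simp only [cb, h, Finset.smul_sum, Matrix.mulVec, dotProduct, Finset.sum_smul, smul_smul]
  rw [Finset.sum_comm]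
  refine Finset.sum_congr rfl fun i _ => Finset.sum_congr rfl fun j _ => ?_
  rw [mul_comm]

theorem cb_inj {n : ℕ} {v : Fin n → V} (hv : LinearIndependent ℚ v) {c d : Fin n → ℤ}
    (h : cb v c = cb v d) : c = d := by
  have h1 : LinearIndependent ℤ v := hv.restrict_scalars' ℤ
  rw [Fintype.linearIndependent_iff] at h1
  have := h1 (c - d) (by
    have : cb v (c - d) = 0 := by
      rw [sub_eq_add_neg, cb_add, h, ← neg_one_smul ℤ d, cb_smul]; simp
    exact this)
  funext i
  exact sub_eq_zero.1 (this i)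

theorem IsBas.mem {n : ℕ} {L : Submodule ℤ V} {v : Fin n → V} (h : IsBas L v) {x : V} :
    x ∈ L ↔ ∃ c, cb v c = x := by
  rw [← h.2, Submodule.mem_span_range_iff_exists_fun]; rfl

theorem IsBas.cb_mem {n : ℕ} {L : Submodule ℤ V} {v : Fin n → V} (h : IsBas L v)
    (c : Fin n → ℤ) : cb v c ∈ L := h.mem.2 ⟨c, rfl⟩

theorem IsBas.v_mem {n : ℕ} {L : Submodule ℤ V} {v : Fin n → V} (h : IsBas L v)
    (i : Fin n) : v i ∈ L := by rw [← cb_single v i]; exact h.cb_mem _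

theorem Gr.cb {n : ℕ} {B : LinearMap.BilinForm ℚ V} {v : Fin n → V}
    {G : Matrix (Fin n) (Fin n) ℤ} (h : Gr B v G) (c d : Fin n → ℤ) :
    B (cb v c) (cb v d) = ((c ⬝ᵥ (G *ᵥ d) : ℤ) : ℚ) := by
  have : ∀ (a : ℤ) (x : V), a • x = (a : ℚ) • x := fun a x => (Int.cast_smul_eq_zsmul ℚ a x).symm
  simp only [_root_.cb, this, map_sum, map_smul, LinearMap.sum_apply, LinearMap.smul_apply, h _ _,
    dotProduct, Matrix.mulVec, smul_eq_mul]
  push_cast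
  simp only [Finset.mul_sum]
  rw [Finset.sum_comm]
  refine Finset.sum_congr rfl fun i _ => Finset.sum_congr rfl fun j _ => ?_
  ring

theorem Gr.trans_mat {n : ℕ} {B : LinearMap.BilinForm ℚ V} {v w : Fin n → V}
    {G H M : Matrix (Fin n) (Fin n) ℤ} (hv : Gr B v G) (hw : Gr B w H)
    (h : ∀ j, v j = _root_.cb w (fun i => M i j)) : G = Mᵀ * H * M := by
  ext i j
  have h1 := hv i j
  rw [h i, h j, hw.cb] at h1
  have h2 : G i j = (fun k => M k i) ⬝ᵥ (H *ᵥ fun k => M k j) := by exact_mod_cast h1.symm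
  rw [h2, Matrix.mul_assoc]
  rfl

theorem Gr.symm' {n : ℕ} {B : LinearMap.BilinForm ℚ V} (hs : ∀ x y : V, B x y = B y x)
    {v : Fin n → V} {G : Matrix (Fin n) (Fin n) ℤ} (hv : Gr B v G) : Gᵀ = G := by
  ext i j
  have h1 := hv i j
  rw [hs, hv j i] at h1
  exact_mod_cast h1

theorem mat_of_le {n : ℕ} {L K : Submodule ℤ V} {v w : Fin n → V} (hv : IsBas L v)
    (hw : IsBas K w) (c : ℤ) (hle : L ≤ K) (hc : ∀ x ∈ K, c • x ∈ L) :
    ∃ M M' : Matrix (Fin n) (Fin n) ℤ, (∀ j, v j = cb w (fun i => M i j)) ∧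
      (∀ j, c • w j = cb v (fun i => M' i j)) ∧ M * M' = c • 1 ∧ M' * M = c • 1 := by
  have h1 : ∀ j, ∃ a, cb w a = v j := fun j => hw.mem.1 (hle (hv.v_mem j))
  have h2 : ∀ j, ∃ a, cb v a = c • w j := fun j => hv.mem.1 (hc _ (hw.v_mem j))
  choose a ha using h1
  choose b hb using h2
  have h3 : ∀ j, v j = cb w (fun i => (Matrix.of fun i j => a j i) i j) := fun j => (ha j).symm
  have h4 : ∀ j, c • w j = cb v (fun i => (Matrix.of fun i j => b j i) i j) :=
    fun j => (hb j).symm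
  refine ⟨Matrix.of fun i j => a j i, Matrix.of fun i j => b j i, h3, h4, ?_, ?_⟩
  · apply Matrix.toLin'.injective
    ext1 j; ext1
    apply cb_inj hw.1
    simp only [LinearMap.comp_apply, Matrix.toLin'_apply, LinearMap.single_apply]
    rw [← Matrix.mulVec_mulVec, ← cb_cb _ _ _ h3, ← cb_cb (fun j => c • w j) _ _ h4, cb_single,
      Matrix.smul_mulVec, Matrix.one_mulVec, cb_smul, cb_single]
  · apply Matrix.toLin'.injective
    ext1 j; ext1
    apply cb_inj hv.1
    simp only [LinearMap.comp_apply, Matrix.toLin'_apply, LinearMap.single_apply]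
    have h5 : ∀ d, cb (fun j => c • w j) d = c • cb w d := by
      intro d; simp only [cb, Finset.smul_sum]
      exact Finset.sum_congr rfl fun i _ => smul_comm _ _ _
    rw [← Matrix.mulVec_mulVec, ← cb_cb (fun j => c • w j) _ _ h4, h5, ← cb_cb _ _ _ h3, cb_single,
      Matrix.smul_mulVec, Matrix.one_mulVec, cb_smul, cb_single]

theorem exists_bas [FiniteDimensional ℚ V] {L : Submodule ℤ V} (hfg : L.FG)
    (hsp : Submodule.span ℚ (L : Set V) = ⊤) :
    ∃ v : Fin (Module.finrank ℚ V) → V, IsBas L v := by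
  have : Module.Finite ℤ L := Module.Finite.iff_fg.2 hfg
  have : IsAddTorsionFree V := .of_module_rat V
  have : Module.Free ℤ L := inferInstance
  let b := Module.finBasis ℤ L
  have hli : LinearIndependent ℚ (fun i => (b i : V)) := by
    rw [← LinearIndependent.iff_fractionRing ℤ ℚ]
    exact b.linearIndependent.map' L.subtype (Submodule.ker_subtype L)
  have hspan : Submodule.span ℤ (Set.range fun i => (b i : V)) = L := by
    have : Set.range (fun i => (b i : V)) = L.subtype '' Set.range b := by
      rw [← Set.range_comp]; rfl
    rw [this, Submodule.span_image, b.span_eq, Submodule.map_top, Submodule.range_subtype]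
  have hcard : Module.finrank ℤ L = Module.finrank ℚ V := by
    have hs : ⊤ ≤ Submodule.span ℚ (Set.range fun i => (b i : V)) := by
      rw [← hsp, Submodule.span_le]
      intro x hx
      rw [← hspan] at hx
      exact Submodule.span_le_restrictScalars ℤ ℚ _ hx
    have := Module.finrank_eq_card_basis (Module.Basis.mk hli hs)
    simpa using this.symm
  rw [← hcard]
  exact ⟨_, hli, hspan⟩

theorem IsBas.dim [FiniteDimensional ℚ V] {n : ℕ} {L : Submodule ℤ V} {v : Fin n → V}
    (h : IsBas L v) (hsp : Submodule.span ℚ (L : Set V) = ⊤) : n = Module.finrank ℚ V := by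
  have hs : ⊤ ≤ Submodule.span ℚ (Set.range v) := by
    rw [← hsp, Submodule.span_le]
    intro x hx
    rw [← h.2] at hx
    exact Submodule.span_le_restrictScalars ℤ ℚ _ hx
  have := Module.finrank_eq_card_basis (Module.Basis.mk h.1 hs)
  simpa using this.symm

theorem exists_gram {n : ℕ} {B : LinearMap.BilinForm ℚ V} {L : Submodule ℤ V}
    (hL : IsIntegralLatticeOn B L) {v : Fin n → V} (hv : IsBas L v) : ∃ G, Gr B v G := by
  have : ∀ i j, ∃ k : ℤ, B (v i) (v j) = k := fun i j => hL.2.2.1 _ (hv.v_mem i) _ (hv.v_mem j)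
  choose G hG using this
  exact ⟨G, hG⟩

end WatsonHelpers

section PadicHelpers

/-- Watson condition over a commutative ring -/
def WS {R : Type*} [CommRing R] {n : ℕ} (m : R) (G : Matrix (Fin n) (Fin n) R) (y : Fin n → R) :
    Prop := m ∣ y ⬝ᵥ (G *ᵥ y) ∧ ∀ i, m ∣ 2 * (G *ᵥ y) i

/-- cast of an integer matrix -/
def cm (R : Type*) [CommRing R] {n : ℕ} (A : Matrix (Fin n) (Fin n) ℤ) :
    Matrix (Fin n) (Fin n) R := A.map Int.cast

/-- cast of an integer vector -/
def cv (R : Type*) [CommRing R] {n : ℕ} (x : Fin n → ℤ) : Fin n → R := fun i => (x i : R)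

theorem cm_mul (R : Type*) [CommRing R] {n : ℕ} (A C : Matrix (Fin n) (Fin n) ℤ) :
    cm R (A * C) = cm R A * cm R C := by
  ext i j; simp [cm, Matrix.mul_apply]

theorem cm_tr (R : Type*) [CommRing R] {n : ℕ} (A : Matrix (Fin n) (Fin n) ℤ) :
    cm R Aᵀ = (cm R A)ᵀ := rfl

theorem cm_smul_one (R : Type*) [CommRing R] {n : ℕ} (c : ℤ) :
    cm R (c • (1 : Matrix (Fin n) (Fin n) ℤ)) = (c : R) • 1 := by
  ext i j
  simp only [cm, Matrix.map_apply, Matrix.smul_apply, Matrix.one_apply]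
  split_ifs <;> simp

theorem cm_mulVec (R : Type*) [CommRing R] {n : ℕ} (A : Matrix (Fin n) (Fin n) ℤ) (x : Fin n → ℤ) :
    cm R A *ᵥ cv R x = cv R (A *ᵥ x) := by
  funext i; simp [cm, cv, Matrix.mulVec, dotProduct]

theorem cv_dot (R : Type*) [CommRing R] {n : ℕ} (x y : Fin n → ℤ) :
    cv R x ⬝ᵥ cv R y = ((x ⬝ᵥ y : ℤ) : R) := by
  simp [cv, dotProduct]

theorem cv_add (R : Type*) [CommRing R] {n : ℕ} (x y : Fin n → ℤ) :
    cv R (x + y) = cv R x + cv R y := by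
  funext i; simp [cv]

theorem cv_smul (R : Type*) [CommRing R] {n : ℕ} (c : ℤ) (x : Fin n → ℤ) :
    cv R (c • x) = (c : R) • cv R x := by
  funext i; simp [cv]

theorem WS_map {R : Type*} [CommRing R] {n : ℕ} (m : R) (G W : Matrix (Fin n) (Fin n) R)
    (y : Fin n → R) (hW : IsUnit W.det) : WS m (Wᵀ * G * W) y ↔ WS m G (W *ᵥ y) := by
  have h1 : y ⬝ᵥ ((Wᵀ * G * W) *ᵥ y) = (W *ᵥ y) ⬝ᵥ (G *ᵥ (W *ᵥ y)) := by
    rw [← Matrix.mulVec_mulVec, ← Matrix.mulVec_mulVec, Matrix.dotProduct_mulVec,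
      Matrix.vecMul_transpose]
  have key : ∀ (A : Matrix (Fin n) (Fin n) R) (z : Fin n → R), (∀ i, m ∣ 2 * z i) →
      ∀ i, m ∣ 2 * (A *ᵥ z) i := by
    intro A z hz i
    simp only [Matrix.mulVec, dotProduct, Finset.mul_sum]
    refine Finset.dvd_sum fun j _ => ?_
    rw [mul_left_comm]
    exact (hz j).mul_left _
  unfold WS
  rw [h1]
  refine and_congr_right fun _ => ⟨fun h => ?_, fun h => ?_⟩
  · have h2 := key (Wᵀ)⁻¹ _ h
    rwa [← Matrix.mulVec_mulVec, ← Matrix.mulVec_mulVec, Matrix.mulVec_mulVec _ (Wᵀ)⁻¹,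
      Matrix.nonsing_inv_mul _ (by rwa [Matrix.det_transpose]), Matrix.one_mulVec] at h2
  · rw [← Matrix.mulVec_mulVec, ← Matrix.mulVec_mulVec]
    exact key _ _ h

theorem WS_add_smul {R : Type*} [CommRing R] {n : ℕ} (m : R) (G : Matrix (Fin n) (Fin n) R)
    (hG : Gᵀ = G) (y e : Fin n → R) (h : WS m G y) : WS m G (y + m • e) := by
  have h3 : y ⬝ᵥ (G *ᵥ e) = e ⬝ᵥ (G *ᵥ y) := by
    rw [Matrix.dotProduct_mulVec, ← Matrix.mulVec_transpose, hG, dotProduct_comm]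
  constructor
  · have : (y + m • e) ⬝ᵥ (G *ᵥ (y + m • e)) = y ⬝ᵥ (G *ᵥ y) +
        m * (2 * (e ⬝ᵥ (G *ᵥ y)) + m * (e ⬝ᵥ (G *ᵥ e))) := by
      simp only [Matrix.mulVec_add, Matrix.mulVec_smul, dotProduct_add, add_dotProduct,
        smul_dotProduct, dotProduct_smul, smul_eq_mul, h3]
      ring
    rw [this]
    exact dvd_add h.1 (dvd_mul_right _ _)
  · intro i
    rw [Matrix.mulVec_add, Matrix.mulVec_smul]
    simp only [Pi.add_apply, Pi.smul_apply, smul_eq_mul, mul_add]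
    refine dvd_add (h.2 i) ?_
    rw [mul_left_comm]
    exact dvd_mul_right _ _

variable {q : ℕ} [Fact q.Prime]

theorem dvd_cast {m e : ℕ} (hm : m = q ^ e) (a : ℤ) : ((m : ℤ) : ℤ_[q]) ∣ (a : ℤ_[q]) ↔ (m : ℤ) ∣ a := by
  subst hm
  have := PadicInt.pow_p_dvd_int_iff (p := q) e a
  push_cast
  exact this

theorem approx {m e : ℕ} (hm : m = q ^ e) (x : ℤ_[q]) :
    ∃ a : ℤ, ∃ b, x = a + ((m : ℤ) : ℤ_[q]) * b := by
  have := PadicInt.appr_spec e x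
  rw [Ideal.mem_span_singleton] at this
  obtain ⟨b, hb⟩ := this
  refine ⟨PadicInt.appr x e, b, ?_⟩
  subst hm
  push_cast
  rw [← hb]; ring

theorem WS_cast {m e : ℕ} (hm : m = q ^ e) {n : ℕ} (G : Matrix (Fin n) (Fin n) ℤ) (c : Fin n → ℤ) :
    WS ((m : ℤ) : ℤ_[q]) (cm _ G) (cv _ c) ↔ WS (m : ℤ) G c := by
  unfold WS
  rw [cm_mulVec, cv_dot, dvd_cast hm]
  refine and_congr_right fun _ => forall_congr' fun i => ?_
  rw [← dvd_cast hm (q := q)]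
  simp [cv]

theorem cancel_mulVec {R : Type*} [CommRing R] [IsDomain R] {n : ℕ} {M M' : Matrix (Fin n) (Fin n) R}
    {m : R} (hm : m ≠ 0) (h : M' * M = m • 1) {x y : Fin n → R} (hxy : M *ᵥ x = M *ᵥ y) : x = y := by
  have := congrArg (M' *ᵥ ·) hxy
  simp only [Matrix.mulVec_mulVec, h, Matrix.smul_mulVec, Matrix.one_mulVec] at this
  exact smul_right_injective _ hm this

theorem cancel_mul {R : Type*} [CommRing R] [IsDomain R] {n : ℕ} {M M' : Matrix (Fin n) (Fin n) R}
    {m : R} (hm : m ≠ 0) (h : M' * M = m • 1) {x y : Matrix (Fin n) (Fin n) R}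
    (hxy : M * x = M * y) : x = y := by
  have := congrArg (M' * ·) hxy
  simp only [← Matrix.mul_assoc, h, Matrix.smul_mul, Matrix.one_mul] at this
  exact smul_right_injective _ hm this

theorem WS_range {m e : ℕ} (hm : m = q ^ e) {n : ℕ} (G M M' : Matrix (Fin n) (Fin n) ℤ)
    (hG : Gᵀ = G) (hMM : M * M' = (m : ℤ) • 1)
    (h : ∀ c, WS (m : ℤ) G c ↔ ∃ d, M *ᵥ d = c) (y : Fin n → ℤ_[q]) :
    WS ((m : ℤ) : ℤ_[q]) (cm _ G) y ↔ ∃ d, cm _ M *ᵥ d = y := by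
  have hG' : (cm ℤ_[q] G)ᵀ = cm _ G := by rw [← cm_tr, hG]
  have hMM' : cm ℤ_[q] M * cm _ M' = ((m : ℤ) : ℤ_[q]) • 1 := by
    rw [← cm_mul, hMM, cm_smul_one]
  have happ : ∀ y : Fin n → ℤ_[q], ∃ a : Fin n → ℤ, ∃ b, y = cv _ a + ((m : ℤ) : ℤ_[q]) • b := by
    intro y
    choose a b hab using fun i => approx hm (y i)
    exact ⟨a, b, funext hab⟩
  constructor
  · intro hy
    obtain ⟨a, b, rfl⟩ := happ y
    have h1 := WS_add_smul _ _ hG' _ (-b) hy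
    rw [smul_neg, add_neg_cancel_right, WS_cast hm, h] at h1
    obtain ⟨d, rfl⟩ := h1
    refine ⟨cv _ d + cm _ M' *ᵥ b, ?_⟩
    rw [Matrix.mulVec_add, cm_mulVec, Matrix.mulVec_mulVec, hMM', Matrix.smul_mulVec,
      Matrix.one_mulVec]
  · rintro ⟨d, rfl⟩
    obtain ⟨a, b, rfl⟩ := happ d
    rw [Matrix.mulVec_add, Matrix.mulVec_smul, cm_mulVec]
    apply WS_add_smul _ _ hG'
    rw [WS_cast hm, h]
    exact ⟨a, rfl⟩

theorem isUnit_cast_of_ne {p : ℕ} [Fact p.Prime] {m e : ℕ} (hm : m = q ^ e) (hpq : p ≠ q) :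
    IsUnit ((m : ℤ) : ℤ_[p]) := by
  subst hm
  have hq : IsUnit (q : ℤ_[p]) := by
    by_contra hcon
    rw [PadicInt.not_isUnit_iff] at hcon
    have := (PadicInt.norm_int_lt_one_iff_dvd (p := p) (q : ℤ)).1 (by exact_mod_cast hcon)
    rw [Int.natCast_dvd_natCast] at this
    exact hpq ((Nat.prime_dvd_prime_iff_eq Fact.out Fact.out).1 this)
  push_cast
  exact hq.pow e

end PadicHelpers

theorem PadicIsomZ.symm' {p : ℕ} {hp : p.Prime} {n : ℕ} {G H : Matrix (Fin n) (Fin n) ℤ}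
    (h : PadicIsomZ p hp G H) : PadicIsomZ p hp H G := by
  have : Fact p.Prime := ⟨hp⟩
  obtain ⟨U, hU, h⟩ := h
  refine ⟨U⁻¹, ?_, ?_⟩
  · exact (Matrix.isUnit_nonsing_inv_det_iff).2 hU
  · rw [← h, Matrix.transpose_nonsing_inv]
    have hU' : IsUnit (Uᵀ).det := by rwa [Matrix.det_transpose]
    rw [Matrix.mul_assoc, Matrix.mul_assoc, Matrix.mul_nonsing_inv _ hU, Matrix.mul_one,
      ← Matrix.mul_assoc, Matrix.nonsing_inv_mul _ hU', Matrix.one_mul]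

theorem PadicIsomZ.trans' {p : ℕ} {hp : p.Prime} {n : ℕ} {G H K : Matrix (Fin n) (Fin n) ℤ}
    (h : PadicIsomZ p hp G H) (h' : PadicIsomZ p hp H K) : PadicIsomZ p hp G K := by
  have : Fact p.Prime := ⟨hp⟩
  obtain ⟨U, hU, h⟩ := h
  obtain ⟨W, hW, h'⟩ := h'
  refine ⟨U * W, ?_, ?_⟩
  · rw [Matrix.det_mul]; exact hU.mul hW
  · rw [← h', ← h, Matrix.transpose_mul]; simp only [Matrix.mul_assoc]

theorem PadicIsomZ.of_mat {p : ℕ} {hp : p.Prime} {n : ℕ} {G H M M' : Matrix (Fin n) (Fin n) ℤ}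
    {c : ℤ} (h : M * M' = c • 1) (hG : H = Mᵀ * G * M)
    (hc : letI : Fact p.Prime := ⟨hp⟩; IsUnit (c : ℤ_[p])) : PadicIsomZ p hp G H := by
  have : Fact p.Prime := ⟨hp⟩
  refine ⟨cm _ M, ?_, ?_⟩
  · have h1 : (cm ℤ_[p] M * cm _ M').det = (c : ℤ_[p]) ^ n := by
      rw [← cm_mul, h, cm_smul_one, Matrix.det_smul]; simp
    rw [Matrix.det_mul] at h1
    have h2 : IsUnit ((c : ℤ_[p]) ^ n) := IsUnit.pow n hc
    rw [← h1] at h2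
    exact isUnit_of_mul_isUnit_left h2
  · change (cm ℤ_[p] M)ᵀ * cm _ G * cm _ M = cm _ H
    rw [hG, cm_mul, cm_mul, cm_tr]

section WatsonMain

variable {V : Type*} [AddCommGroup V] [Module ℚ V]

theorem watson_iff {B : LinearMap.BilinForm ℚ V} (hs : ∀ x y : V, B x y = B y x) {n m : ℕ}
    {T : Submodule ℤ V} {s : Fin n → V} {G : Matrix (Fin n) (Fin n) ℤ} (hb : IsBas T s)
    (hG : Gr B s G) (c : Fin n → ℤ) : cb s c ∈ watsonSet m B T ↔ WS (m : ℤ) G c := by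
  have key : ∀ d : Fin n → ℤ, B (cb s c + cb s d) (cb s c + cb s d) - B (cb s d) (cb s d) =
      ((c ⬝ᵥ (G *ᵥ c) + 2 * (d ⬝ᵥ (G *ᵥ c)) : ℤ) : ℚ) := by
    intro d
    simp only [map_add, LinearMap.add_apply]
    rw [hs (cb s c) (cb s d)]
    push_cast
    rw [← hG.cb c c, ← hG.cb d c]
    ring
  have key2 : (cb s c ∈ watsonSet m B T) ↔
      ∀ d : Fin n → ℤ, (m : ℤ) ∣ c ⬝ᵥ (G *ᵥ c) + 2 * (d ⬝ᵥ (G *ᵥ c)) := by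
    constructor
    · intro h d
      obtain ⟨k, hk⟩ := h.2 _ (hb.cb_mem d)
      rw [key] at hk
      exact ⟨k, by exact_mod_cast hk⟩
    · intro h
      refine ⟨hb.cb_mem c, fun y hy => ?_⟩
      obtain ⟨d, rfl⟩ := hb.mem.1 hy
      obtain ⟨k, hk⟩ := h d
      exact ⟨k, by rw [key, hk]; push_cast; ring⟩
  rw [key2]
  constructor
  · intro h
    have h0 : (m : ℤ) ∣ c ⬝ᵥ (G *ᵥ c) := by simpa using h 0
    refine ⟨h0, fun i => ?_⟩
    have := h (Pi.single i 1)
    rw [single_dotProduct, one_mul] at this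
    exact (Int.dvd_add_right h0).1 this
  · intro h d
    refine dvd_add h.1 ?_
    simp only [dotProduct, Finset.mul_sum]
    refine Finset.dvd_sum fun i _ => ?_
    rw [mul_left_comm]
    exact (h.2 i).mul_left _

theorem span_of_smul {L K : Submodule ℤ V} {m : ℕ} (hm : m ≠ 0)
    (h : ∀ x ∈ L, (m : ℤ) • x ∈ K) (hsp : Submodule.span ℚ (L : Set V) = ⊤) :
    Submodule.span ℚ (K : Set V) = ⊤ := by
  rw [eq_top_iff, ← hsp, Submodule.span_le]
  intro x hx
  have h1 : ((m : ℤ) • x) ∈ Submodule.span ℚ (K : Set V) := Submodule.subset_span (h x hx)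
  rw [← Int.cast_smul_eq_zsmul ℚ] at h1
  have h2 := Submodule.smul_mem _ ((m : ℚ)⁻¹) h1
  rw [smul_smul] at h2
  have : (m : ℚ)⁻¹ * ((m : ℤ) : ℚ) = 1 := by
    push_cast; exact inv_mul_cancel₀ (by exact_mod_cast hm)
  rwa [this, one_smul] at h2

theorem watson_lat {B : LinearMap.BilinForm ℚ V} (hs : ∀ x y : V, B x y = B y x) {m : ℕ}
    (hm : m ≠ 0) {L LW : Submodule ℤ V} (hL : IsIntegralLatticeOn B L)
    (hLW : (LW : Set V) = watsonSet m B L) :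
    IsIntegralLatticeOn B LW ∧ LW ≤ L ∧ ∀ x ∈ L, (m : ℤ) • x ∈ LW := by
  have hle : LW ≤ L := by
    intro x hx
    have : x ∈ watsonSet m B L := by rw [← hLW]; exact hx
    exact this.1
  have hmul : ∀ x ∈ L, (m : ℤ) • x ∈ LW := by
    intro x hx
    change (m : ℤ) • x ∈ (LW : Set V)
    rw [hLW]
    refine ⟨L.smul_mem _ hx, fun y hy => ?_⟩
    obtain ⟨k, hk⟩ := hL.2.2.1 x hx x hx
    obtain ⟨l, hl⟩ := hL.2.2.1 x hx y hy
    refine ⟨m * k + 2 * l, ?_⟩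
    rw [← Int.cast_smul_eq_zsmul ℚ]
    simp only [map_add, LinearMap.add_apply, map_smul, LinearMap.smul_apply, smul_eq_mul]
    rw [hs y x, hk, hl]
    push_cast
    ring
  refine ⟨⟨?_, span_of_smul hm hmul hL.2.1, ?_, hL.2.2.2⟩, hle, hmul⟩
  · have : IsNoetherian ℤ L := isNoetherian_of_fg_of_noetherian L hL.1
    have h2 := (IsNoetherian.noetherian (LW.comap L.subtype)).map L.subtype
    rwa [Submodule.map_comap_subtype, inf_eq_right.2 hle] at h2
  · intro x hx y hy
    exact hL.2.2.1 x (hle hx) y (hle hy)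

theorem watson_data [FiniteDimensional ℚ V] {B : LinearMap.BilinForm ℚ V}
    (hs : ∀ x y : V, B x y = B y x) {m : ℕ}
    (hm : m ≠ 0) {L LW : Submodule ℤ V} (hL : IsIntegralLatticeOn B L)
    (hLW : (LW : Set V) = watsonSet m B L) :
    ∃ (u v : Fin (Module.finrank ℚ V) → V)
      (G H M M' : Matrix (Fin (Module.finrank ℚ V)) (Fin (Module.finrank ℚ V)) ℤ),
      IsBas L u ∧ IsBas LW v ∧ Gr B u G ∧ Gr B v H ∧ H = Mᵀ * G * M ∧ Gᵀ = G ∧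
      M * M' = (m : ℤ) • 1 ∧ M' * M = (m : ℤ) • 1 ∧
      ∀ c, WS (m : ℤ) G c ↔ ∃ d, M *ᵥ d = c := by
  obtain ⟨hlat, hle, hmul⟩ := watson_lat hs hm hL hLW
  obtain ⟨u, hu⟩ := exists_bas hL.1 hL.2.1
  obtain ⟨v, hv⟩ := exists_bas hlat.1 hlat.2.1
  obtain ⟨G, hG⟩ := exists_gram hL hu
  obtain ⟨H, hH⟩ := exists_gram hlat hv
  obtain ⟨M, M', h1, h2, h3, h4⟩ := mat_of_le hv hu m hle hmul
  refine ⟨u, v, G, H, M, M', hu, hv, hG, hH, hH.trans_mat hG h1, hG.symm' hs, h3, h4, fun c => ?_⟩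
  rw [← watson_iff hs hu hG, ← hLW]
  change cb u c ∈ LW ↔ _
  rw [hv.mem]
  refine exists_congr fun d => ?_
  rw [cb_cb _ _ _ h1]
  exact ⟨fun h => cb_inj hu.1 h, fun h => by rw [h]⟩

theorem gram_indep {B : LinearMap.BilinForm ℚ V} {n : ℕ} {L : Submodule ℤ V} {u v : Fin n → V}
    {G H : Matrix (Fin n) (Fin n) ℤ} (hu : IsBas L u) (hv : IsBas L v) (hG : Gr B u G)
    (hH : Gr B v H) (p : ℕ) (hp : p.Prime) : PadicIsomZ p hp G H := by
  obtain ⟨M, M', h1, h2, h3, h4⟩ := mat_of_le hv hu 1 le_rfl (by simp)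
  refine PadicIsomZ.of_mat h3 (hH.trans_mat hG h1) ?_
  simp

theorem genus_gram [FiniteDimensional ℚ V] {B : LinearMap.BilinForm ℚ V}
    {L K : Submodule ℤ V} (h : InGenusSub B L K) {u v : Fin (Module.finrank ℚ V) → V}
    {G H : Matrix (Fin (Module.finrank ℚ V)) (Fin (Module.finrank ℚ V)) ℤ}
    (hu : IsBas L u) (hv : IsBas K v) (hG : Gr B u G)
    (hH : Gr B v H) (p : ℕ) (hp : p.Prime) : PadicIsomZ p hp G H := by
  obtain ⟨n, G', H', ⟨u', hu1, hu2, hu3⟩, ⟨v', hv1, hv2, hv3⟩, h1⟩ := h.2 p hp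
  have hn : n = Module.finrank ℚ V := IsBas.dim ⟨hv1, hv2⟩ h.1.2.1
  subst hn
  exact (gram_indep hu ⟨hu1, hu2⟩ hG hu3 p hp).trans'
    (h1.trans' (gram_indep ⟨hv1, hv2⟩ hv hv3 hH p hp))

theorem genus_of [FiniteDimensional ℚ V] {B : LinearMap.BilinForm ℚ V}
    {L K : Submodule ℤ V} {n : ℕ} {u v : Fin n → V}
    {G H : Matrix (Fin n) (Fin n) ℤ} (hK : IsIntegralLatticeOn B K)
    (hu : IsBas L u) (hv : IsBas K v) (hG : Gr B u G)
    (hH : Gr B v H) (h : ∀ (p : ℕ) (hp : p.Prime), PadicIsomZ p hp G H) : InGenusSub B L K :=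
  ⟨hK, fun p hp => ⟨n, G, H, ⟨u, hu.1, hu.2, hG⟩, ⟨v, hv.1, hv.2, hH⟩, h p hp⟩⟩

theorem factor {R : Type*} [CommRing R] {n : ℕ} {M X : Matrix (Fin n) (Fin n) R}
    (h : ∀ j, ∃ d, M *ᵥ d = fun i => X i j) : ∃ W, M * W = X := by
  choose d hd using h
  refine ⟨Matrix.of fun i j => d j i, ?_⟩
  ext i j
  exact congrFun (hd j) i

theorem watson_local {q : ℕ} [Fact q.Prime] {m e : ℕ} (hm : m = q ^ e) {n : ℕ}
    {G M M' G1 M1 M1' : Matrix (Fin n) (Fin n) ℤ}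
    (hG : Gᵀ = G) (hMM : M * M' = (m : ℤ) • 1)
    (hM : ∀ c, WS (m : ℤ) G c ↔ ∃ d, M *ᵥ d = c)
    (hG1 : G1ᵀ = G1) (hMM1 : M1 * M1' = (m : ℤ) • 1)
    (hM1 : ∀ c, WS (m : ℤ) G1 c ↔ ∃ d, M1 *ᵥ d = c)
    {U : Matrix (Fin n) (Fin n) ℤ_[q]} (hU : IsUnit U.det)
    (h : Uᵀ * cm _ G * U = cm _ G1) : ∃ W, cm _ M * W = U * cm _ M1 := by
  apply factor
  intro j
  rw [← WS_range hm G M M' hG hMM hM]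
  have h1 : (fun i => (U * cm ℤ_[q] M1) i j) = U *ᵥ (fun i => cm ℤ_[q] M1 i j) := by
    funext i; rfl
  rw [h1, ← WS_map _ _ _ _ hU, h, WS_range hm G1 M1 M1' hG1 hMM1 hM1]
  refine ⟨Pi.single j 1, ?_⟩
  rw [Matrix.mulVec_single_one]; rfl

theorem part_a [FiniteDimensional ℚ V] {B : LinearMap.BilinForm ℚ V}
    (hs : ∀ x y : V, B x y = B y x) {m q e : ℕ} (hq : q.Prime) (hm : m = q ^ e)
    {L LW T TW : Submodule ℤ V} (hL : IsIntegralLatticeOn B L)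
    (hLW : (LW : Set V) = watsonSet m B L) (hT : InGenusSub B L T)
    (hTW : (TW : Set V) = watsonSet m B T) : InGenusSub B LW TW := by
  have : Fact q.Prime := ⟨hq⟩
  have hm0 : m ≠ 0 := by rw [hm]; exact pow_ne_zero _ hq.ne_zero
  obtain ⟨u, v, G, H, M, M', hu, hv, hG, hH, hHM, hGs, hMM, hMM', hM⟩ := watson_data hs hm0 hL hLW
  obtain ⟨u1, v1, G1, H1, M1, M1', hu1, hv1, hG1, hH1, hHM1, hGs1, hMM1, hMM1', hM1⟩ :=
    watson_data hs hm0 hT.1 hTW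
  refine genus_of (watson_lat hs hm0 hT.1 hTW).1 hv hv1 hH hH1 fun p hp => ?_
  have hiso := genus_gram hT hu hu1 hG hG1 p hp
  by_cases hpq : p = q
  · subst hpq
    obtain ⟨U, hU, hUG⟩ := hiso
    change Uᵀ * cm _ G * U = cm _ G1 at hUG
    obtain ⟨W, hW⟩ := watson_local hm hGs hMM hM hGs1 hMM1 hM1 hU hUG
    have hU' : IsUnit (Uᵀ).det := by rwa [Matrix.det_transpose]
    have hUG' : (U⁻¹)ᵀ * cm _ G1 * U⁻¹ = cm _ G := by
      rw [← hUG, Matrix.transpose_nonsing_inv, Matrix.mul_assoc, Matrix.mul_assoc,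
        Matrix.mul_nonsing_inv _ hU, Matrix.mul_one,
        ← Matrix.mul_assoc, Matrix.nonsing_inv_mul _ hU', Matrix.one_mul]
    obtain ⟨W', hW'⟩ := watson_local hm hGs1 hMM1 hM1 hGs hMM hM
      ((Matrix.isUnit_nonsing_inv_det_iff).2 hU) hUG'
    have hm0' : ((m : ℤ) : ℤ_[p]) ≠ 0 := by exact_mod_cast hm0
    have hWW : W * W' = 1 := by
      apply cancel_mul (M := cm ℤ_[p] M) (M' := cm _ M') hm0'
      · rw [← cm_mul, hMM', cm_smul_one]
      · rw [← Matrix.mul_assoc, hW, Matrix.mul_assoc, hW', ← Matrix.mul_assoc,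
          Matrix.mul_nonsing_inv _ hU, Matrix.one_mul, Matrix.mul_one]
    refine ⟨W, ?_, ?_⟩
    · have := congrArg Matrix.det hWW
      rw [Matrix.det_mul, Matrix.det_one] at this
      exact IsUnit.of_mul_eq_one _ this
    · change Wᵀ * cm _ H * W = cm _ H1
      rw [hHM, hHM1]
      simp only [cm_mul, cm_tr]
      calc Wᵀ * ((cm ℤ_[p] M)ᵀ * cm _ G * cm _ M) * W
          = (cm _ M * W)ᵀ * cm _ G * (cm _ M * W) := by
            simp only [Matrix.transpose_mul, Matrix.mul_assoc]
        _ = (cm ℤ_[p] M1)ᵀ * (Uᵀ * cm _ G * U) * cm _ M1 := by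
            rw [hW]; simp only [Matrix.transpose_mul, Matrix.mul_assoc]
        _ = _ := by rw [hUG]
  · have : Fact p.Prime := ⟨hp⟩
    have hc : IsUnit ((m : ℤ) : ℤ_[p]) := isUnit_cast_of_ne hm hpq
    exact (PadicIsomZ.of_mat hMM hHM hc).symm'.trans' (hiso.trans' (PadicIsomZ.of_mat hMM1 hHM1 hc))

/-- the lattice `T` glued from `N` away from `q` and from `L` at `q`. -/
def glue {n q : ℕ} [Fact q.Prime] (m : ℤ) (w : Fin n → V) (A : Matrix (Fin n) (Fin n) ℤ_[q]) :
    Submodule ℤ V where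
  carrier := {t | ∃ (x : Fin n → ℤ) (z : Fin n → ℤ_[q]), m • t = cb w x ∧
    A *ᵥ cv _ x = (m : ℤ_[q]) • z}
  zero_mem' := ⟨0, 0, by simp [cb_zero], by
    have : cv ℤ_[q] (0 : Fin n → ℤ) = 0 := by funext i; simp [cv]
    simp [this]⟩
  add_mem' := by
    rintro a b ⟨x, z, h1, h2⟩ ⟨x', z', h3, h4⟩
    exact ⟨x + x', z + z', by rw [smul_add, h1, h3, cb_add],
      by rw [cv_add, Matrix.mulVec_add, h2, h4, smul_add]⟩
  smul_mem' := by
    rintro c a ⟨x, z, h1, h2⟩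
    exact ⟨c • x, (c : ℤ_[q]) • z, by rw [smul_comm, h1, cb_smul],
      by rw [cv_smul, Matrix.mulVec_smul, h2, smul_comm]⟩

theorem mem_glue {n q : ℕ} [Fact q.Prime] {m : ℤ} {w : Fin n → V}
    {A : Matrix (Fin n) (Fin n) ℤ_[q]} {t : V} :
    t ∈ glue m w A ↔ ∃ (x : Fin n → ℤ) (z : Fin n → ℤ_[q]), m • t = cb w x ∧
      A *ᵥ cv _ x = (m : ℤ_[q]) • z := Iff.rfl

theorem cv_inj {q : ℕ} [Fact q.Prime] {n : ℕ} {x y : Fin n → ℤ} (h : cv ℤ_[q] x = cv _ y) :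
    x = y := by
  funext i
  have := congrFun h i
  simp only [cv] at this
  exact_mod_cast this

theorem part_c [FiniteDimensional ℚ V] {B : LinearMap.BilinForm ℚ V}
    (hs : ∀ x y : V, B x y = B y x) {m q e : ℕ} (hq : q.Prime) (hm : m = q ^ e) (he : e ≠ 0)
    {L LW N : Submodule ℤ V} (hL : IsIntegralLatticeOn B L)
    (hLW : (LW : Set V) = watsonSet m B L) (hN : InGenusSub B LW N) :
    ∃ T : Submodule ℤ V, InGenusSub B L T ∧ watsonSet m B T = (N : Set V) := by
  have : Fact q.Prime := ⟨hq⟩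
  have hm0 : m ≠ 0 := by rw [hm]; exact pow_ne_zero _ hq.ne_zero
  have hmz : (m : ℤ) ≠ 0 := by exact_mod_cast hm0
  have hmR : ((m : ℤ) : ℤ_[q]) ≠ 0 := by exact_mod_cast hm0
  have htf : IsAddTorsionFree V := .of_module_rat V
  have hmV : ∀ {x y : V}, (m : ℤ) • x = (m : ℤ) • y → x = y := fun h =>
    smul_right_injective V hmz h
  obtain ⟨u, v, G, H, M, M', hu, hv, hG, hH, hHM, hGs, hMM, hMM', hM⟩ := watson_data hs hm0 hL hLW
  obtain ⟨w, hw⟩ := exists_bas hN.1.1 hN.1.2.1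
  obtain ⟨H', hH'⟩ := exists_gram hN.1 hw
  have hiso := genus_gram hN hv hw hH hH'
  obtain ⟨U, hU, hUH⟩ := hiso q hq
  change Uᵀ * cm _ H * U = cm _ H' at hUH
  have cMM : cm ℤ_[q] M * cm _ M' = ((m : ℤ) : ℤ_[q]) • 1 := by rw [← cm_mul, hMM, cm_smul_one]
  have cMM' : cm ℤ_[q] M' * cm _ M = ((m : ℤ) : ℤ_[q]) • 1 := by rw [← cm_mul, hMM', cm_smul_one]
  set A : Matrix _ _ ℤ_[q] := cm ℤ_[q] M * U with hA
  have hAG : Aᵀ * cm _ G * A = cm _ H' := by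
    rw [← hUH, hHM, cm_mul, cm_mul, cm_tr, hA, Matrix.transpose_mul]
    simp only [Matrix.mul_assoc]
  set T := glue (m : ℤ) w A with hT
  have hNT : N ≤ T := by
    intro t ht
    obtain ⟨x, rfl⟩ := hw.mem.1 ht
    exact ⟨(m : ℤ) • x, A *ᵥ cv _ x, by rw [cb_smul], by rw [cv_smul, Matrix.mulVec_smul]⟩
  have hmT : ∀ t ∈ T, (m : ℤ) • t ∈ N := by
    rintro t ⟨x, z, h1, h2⟩
    rw [h1]; exact hw.cb_mem x
  have hTfg : T.FG := by
    have hnoe : IsNoetherian ℤ N := isNoetherian_of_fg_of_noetherian N hN.1.1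
    let f : T →ₗ[ℤ] N :=
      { toFun := fun t => ⟨(m : ℤ) • (t : V), hmT t t.2⟩
        map_add' := fun a b => by ext; simp
        map_smul' := fun c a => Subtype.ext (smul_comm _ _ _) }
    have hf : Function.Injective f := fun a b hab => Subtype.ext (hmV (congrArg Subtype.val hab))
    exact Module.Finite.iff_fg.1 (Module.Finite.of_injective f hf)
  have hTsp : Submodule.span ℚ (T : Set V) = ⊤ := by
    rw [eq_top_iff, ← hN.1.2.1]
    exact Submodule.span_mono hNT
  obtain ⟨s, hsT⟩ := exists_bas hTfg hTsp
  obtain ⟨R, R', hwR, hsR, hRR, hRR'⟩ := mat_of_le hw hsT m hNT hmT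
  have cRR : cm ℤ_[q] R * cm _ R' = ((m : ℤ) : ℤ_[q]) • 1 := by rw [← cm_mul, hRR, cm_smul_one]
  have cRR' : cm ℤ_[q] R' * cm _ R = ((m : ℤ) : ℤ_[q]) • 1 := by rw [← cm_mul, hRR', cm_smul_one]
  have hmcb : ∀ d, (m : ℤ) • cb s d = cb w (R' *ᵥ d) := by
    intro d
    rw [← cb_cb (fun j => (m : ℤ) • s j) _ _ hsR]
    simp only [cb, Finset.smul_sum]
    exact Finset.sum_congr rfl fun i _ => smul_comm _ _ _
  -- the local isometry at `q`
  have hWex : ∃ W, A * cm _ R' = ((m : ℤ) : ℤ_[q]) • W := by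
    have : ∀ j, ∃ z : Fin _ → ℤ_[q], A *ᵥ (fun i => cm _ R' i j) = ((m : ℤ) : ℤ_[q]) • z := by
      intro j
      obtain ⟨x, z, h1, h2⟩ := hsT.v_mem j
      rw [hsR j] at h1
      have := cb_inj hw.1 h1
      subst this
      exact ⟨z, h2⟩
    choose z hz using this
    refine ⟨Matrix.of fun i j => z j i, ?_⟩
    ext1 i j
    exact congrFun (hz j) i
  obtain ⟨W, hW⟩ := hWex
  have hWdet : IsUnit W.det := by
    have hm2 : m ^ 2 = q ^ (e * 2) := by rw [hm, pow_mul]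
    choose X E hXE using fun i j => approx hm2 ((U⁻¹ * cm ℤ_[q] M') i j)
    have hX : U⁻¹ * cm ℤ_[q] M' = cm _ (Matrix.of X) +
        (((m : ℤ) : ℤ_[q]) * ((m : ℤ) : ℤ_[q])) • Matrix.of E := by
      ext1 i j
      rw [hXE]
      simp only [cm, Matrix.add_apply, Matrix.smul_apply, Matrix.map_apply, Matrix.of_apply,
        smul_eq_mul]
      push_cast
      ring
    have hAX : A * cm _ (Matrix.of X) =
        ((m : ℤ) : ℤ_[q]) • (1 - ((m : ℤ) : ℤ_[q]) • (A * Matrix.of E)) := by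
      rw [← sub_eq_iff_eq_add] at hX
      rw [← hX, Matrix.mul_sub, hA, Matrix.mul_assoc, ← Matrix.mul_assoc U,
        Matrix.mul_nonsing_inv _ hU, Matrix.one_mul, cMM, Matrix.mul_smul, smul_sub, smul_smul]
    have hC : ∃ C, R' * C = Matrix.of X := by
      apply factor
      intro j
      have ht : ∃ t : V, (m : ℤ) • t = cb w (fun i => X i j) := by
        refine ⟨(m : ℚ)⁻¹ • cb w (fun i => X i j), ?_⟩
        rw [← Int.cast_smul_eq_zsmul ℚ, smul_smul]
        have : ((m : ℤ) : ℚ) * (m : ℚ)⁻¹ = 1 := by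
          push_cast; exact mul_inv_cancel₀ (by exact_mod_cast hm0)
        rw [this, one_smul]
      obtain ⟨t, ht⟩ := ht
      have htT : t ∈ T := by
        refine ⟨_, fun i => (1 - ((m : ℤ) : ℤ_[q]) • (A * Matrix.of E)) i j, ht, ?_⟩
        funext i
        exact congrFun (congrFun hAX i) j
      obtain ⟨d, rfl⟩ := hsT.mem.1 htT
      rw [hmcb] at ht
      exact ⟨d, cb_inj hw.1 ht⟩
    obtain ⟨C, hC⟩ := hC
    have hWC : W * cm _ C = 1 - ((m : ℤ) : ℤ_[q]) • (A * Matrix.of E) := by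
      apply smul_right_injective _ hmR
      simp only
      rw [← hAX, ← hC, cm_mul, ← Matrix.mul_assoc, hW, Matrix.smul_mul]
    have hdet : IsUnit (W * cm _ C).det := by
      rw [hWC]
      have hmem : ((m : ℤ) : ℤ_[q]) ∈ IsLocalRing.maximalIdeal ℤ_[q] := by
        rw [PadicInt.maximalIdeal_eq_span_p, Ideal.mem_span_singleton, hm]
        push_cast
        exact dvd_pow_self _ he
      rw [← IsLocalRing.notMem_maximalIdeal, ← IsLocalRing.residue_eq_zero_iff]
      have hres : IsLocalRing.residue ℤ_[q] ((m : ℤ) : ℤ_[q]) = 0 :=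
        (IsLocalRing.residue_eq_zero_iff _).2 hmem
      rw [RingHom.map_det]
      have : (IsLocalRing.residue ℤ_[q]).mapMatrix
          (1 - ((m : ℤ) : ℤ_[q]) • (A * Matrix.of E)) = 1 := by
        rw [map_sub, map_one, sub_eq_self]
        ext i j
        simp only [RingHom.mapMatrix_apply, Matrix.map_apply, Matrix.smul_apply, smul_eq_mul,
          map_mul, hres, zero_mul, Matrix.zero_apply]
      rw [this, Matrix.det_one]
      exact one_ne_zero
    rw [Matrix.det_mul] at hdet
    exact isUnit_of_mul_isUnit_left hdet
  -- integrality of `T`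
  have hWG : cm ℤ_[q] (R'ᵀ * H' * R') =
      (((m : ℤ) : ℤ_[q]) * ((m : ℤ) : ℤ_[q])) • (Wᵀ * cm _ G * W) := by
    rw [cm_mul, cm_mul, cm_tr, ← hAG]
    calc (cm ℤ_[q] R')ᵀ * (Aᵀ * cm ℤ_[q] G * A) * cm ℤ_[q] R'
        = (A * cm ℤ_[q] R')ᵀ * cm ℤ_[q] G * (A * cm ℤ_[q] R') := by
          simp only [Matrix.transpose_mul, Matrix.mul_assoc]
      _ = _ := by
          rw [hW]
          simp only [Matrix.transpose_smul, Matrix.smul_mul, Matrix.mul_smul, smul_smul]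
  have hmsB : ∀ i j, (m : ℚ) * m * B (s i) (s j) = (((R'ᵀ * H' * R') i j : ℤ) : ℚ) := by
    intro i j
    have h1 : B ((m : ℤ) • s i) ((m : ℤ) • s j) = (m : ℚ) * m * B (s i) (s j) := by
      rw [← Int.cast_smul_eq_zsmul ℚ, ← Int.cast_smul_eq_zsmul ℚ]
      simp only [map_smul, LinearMap.smul_apply, smul_eq_mul]
      push_cast
      ring
    rw [← h1, hsR i, hsR j, hH'.cb, Matrix.mul_assoc]
    rfl
  have hGex : ∀ i j, ∃ k : ℤ, B (s i) (s j) = k ∧ (R'ᵀ * H' * R') i j = (m : ℤ) * m * k := by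
    intro i j
    have hm2 : m * m = q ^ (e + e) := by rw [hm, pow_add]
    have h1 : ((m * m : ℕ) : ℤ) ∣ (R'ᵀ * H' * R') i j := by
      rw [← dvd_cast hm2 (q := q)]
      have h2 := congrFun (congrFun hWG i) j
      simp only [cm, Matrix.map_apply, Matrix.smul_apply, smul_eq_mul] at h2
      rw [h2]
      push_cast
      exact dvd_mul_right _ _
    obtain ⟨k, hk⟩ := h1
    push_cast at hk
    refine ⟨k, ?_, hk⟩
    have h3 := hmsB i j
    rw [hk] at h3
    push_cast at h3
    have hmq : (m : ℚ) * m ≠ 0 := by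
      have : (m : ℚ) ≠ 0 := by exact_mod_cast hm0
      positivity
    exact mul_left_cancel₀ hmq h3
  choose GT hGT hGT2 using hGex
  have hgr : Gr B s (Matrix.of GT) := hGT
  have hTlat : IsIntegralLatticeOn B T := by
    refine ⟨hTfg, hTsp, ?_, hL.2.2.2⟩
    intro x hx y hy
    obtain ⟨c, rfl⟩ := hsT.mem.1 hx
    obtain ⟨d, rfl⟩ := hsT.mem.1 hy
    exact ⟨_, hgr.cb c d⟩
  have hWGT : Wᵀ * cm _ G * W = cm ℤ_[q] (Matrix.of GT) := by
    apply smul_right_injective _ (mul_ne_zero hmR hmR)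
    simp only
    rw [← hWG]
    ext1 i j
    simp only [cm, Matrix.map_apply, Matrix.smul_apply, Matrix.of_apply, hGT2, smul_eq_mul]
    push_cast
    ring
  refine ⟨T, genus_of hTlat hu hsT hG hgr fun p hp => ?_, ?_⟩
  · by_cases hpq : p = q
    · subst hpq
      exact ⟨W, hWdet, hWGT⟩
    · have : Fact p.Prime := ⟨hp⟩
      have hc : IsUnit ((m : ℤ) : ℤ_[p]) := isUnit_cast_of_ne hm hpq
      exact (PadicIsomZ.of_mat hMM hHM hc).trans' ((hiso p hp).trans'
        (PadicIsomZ.of_mat hRR (hH'.trans_mat hgr hwR) hc).symm')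
  · -- the Watson transform of `T` is `N`
    have hmain : ∀ c, WS (m : ℤ) (Matrix.of GT) c ↔ ∃ d, R *ᵥ d = c := by
      intro c
      rw [← WS_cast hm (q := q), ← hWGT, WS_map _ _ _ _ hWdet, WS_range hm G M M' hGs hMM hM]
      have hmW : ((m : ℤ) : ℤ_[q]) • (W *ᵥ cv _ c) = cm _ M *ᵥ (U *ᵥ cv _ (R' *ᵥ c)) := by
        rw [← Matrix.smul_mulVec, ← hW, ← Matrix.mulVec_mulVec, cm_mulVec, hA,
          ← Matrix.mulVec_mulVec]
      constructor
      · rintro ⟨d', hd'⟩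
        rw [← hd', ← Matrix.mulVec_smul] at hmW
        have h1 := cancel_mulVec hmR cMM' hmW
        have h2 := congrArg (U⁻¹ *ᵥ ·) h1
        simp only [Matrix.mulVec_mulVec, Matrix.nonsing_inv_mul _ hU, Matrix.one_mulVec,
          Matrix.mulVec_smul] at h2
        have h3 : ∀ i, ∃ k, (R' *ᵥ c) i = (m : ℤ) * k := by
          intro i
          have h4 : (m : ℤ) ∣ (R' *ᵥ c) i := by
            rw [← dvd_cast hm (q := q)]
            exact ⟨_, (congrFun h2 i).symm⟩
          exact h4
        choose d hd using h3
        refine ⟨d, ?_⟩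
        have h5 : R' *ᵥ c = (m : ℤ) • d := funext hd
        apply cancel_mulVec hmz hRR
        rw [Matrix.mulVec_mulVec, hRR', h5, Matrix.smul_mulVec, Matrix.one_mulVec]
      · rintro ⟨d, rfl⟩
        refine ⟨U *ᵥ cv _ d, ?_⟩
        apply smul_right_injective _ hmR
        simp only
        rw [hmW, Matrix.mulVec_mulVec d R' R, hRR', Matrix.smul_mulVec, Matrix.one_mulVec, cv_smul,
          Matrix.mulVec_smul, Matrix.mulVec_smul]
    ext t
    constructor
    · intro ht
      obtain ⟨c, rfl⟩ := hsT.mem.1 ht.1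
      obtain ⟨d, rfl⟩ := (hmain c).1 ((watson_iff hs hsT hgr c).1 ht)
      rw [← cb_cb _ _ _ hwR]
      exact hw.cb_mem d
    · intro ht
      obtain ⟨d, rfl⟩ := hw.mem.1 ht
      rw [cb_cb _ _ _ hwR]
      exact (watson_iff hs hsT hgr _).2 ((hmain _).2 ⟨d, rfl⟩)

theorem watson_map {B : LinearMap.BilinForm ℚ V} (m : ℕ) (L : Submodule ℤ V) (σ : V ≃ₗ[ℚ] V)
    (hσ : IsIsometryOfSpace B σ) : σ '' watsonSet m B L = watsonSet m B (mapLat σ L) := by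
  have key : ∀ x y, B (σ x + σ y) (σ x + σ y) - B (σ y) (σ y) = B (x + y) (x + y) - B y y := by
    intro x y
    rw [← map_add, hσ, hσ]
  ext z
  constructor
  · rintro ⟨x, ⟨hx, h⟩, rfl⟩
    refine ⟨⟨x, hx, rfl⟩, ?_⟩
    rintro _ ⟨y, hy, rfl⟩
    obtain ⟨k, hk⟩ := h y hy
    exact ⟨k, (key x y).trans hk⟩
  · rintro ⟨⟨x, hx, rfl⟩, h⟩
    refine ⟨x, ⟨hx, fun y hy => ?_⟩, rfl⟩
    obtain ⟨k, hk⟩ := h _ ⟨y, hy, rfl⟩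
    exact ⟨k, (key x y).symm.trans hk⟩

theorem mapLat_watson {B : LinearMap.BilinForm ℚ V} (m : ℕ) (L K LW KW : Submodule ℤ V)
    (σ : V ≃ₗ[ℚ] V) (hσ : IsIsometryOfSpace B σ) (h : mapLat σ L = K)
    (hLW : (LW : Set V) = watsonSet m B L) (hKW : (KW : Set V) = watsonSet m B K) :
    mapLat σ LW = KW := by
  apply SetLike.coe_injective
  rw [hKW, ← h, ← watson_map m L σ hσ, ← hLW]
  rfl
end WatsonMain

/-- For a lattice `L` on a quadratic space `V` and `m` a prime or `4`:
(1) `σ(Λ_m(L)) = Λ_m(σ(L))` for all `σ ∈ O(V)`, and in particular `O(L) ⊆ O(Λ_m(L))`;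
(2) `Λ_m` induces a surjection `gen(L)/∼ ↠ gen(Λ_m(L))/∼`. -/
theorem watson_commutes_and_genus_surjective
    {V : Type*} [AddCommGroup V] [Module ℚ V] [FiniteDimensional ℚ V]
    (B : LinearMap.BilinForm ℚ V) (hsymm : ∀ x y : V, B x y = B y x)
    (L : Submodule ℤ V) (hL : IsIntegralLatticeOn B L)
    (m : ℕ) (hm : m.Prime ∨ m = 4) :
    -- (1)
    (∀ σ : V ≃ₗ[ℚ] V, IsIsometryOfSpace B σ →
      σ '' watsonSet m B L = watsonSet m B (mapLat σ L)) ∧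
    (∀ σ : V ≃ₗ[ℚ] V, IsIsometryOfSpace B σ → mapLat σ L = L →
      ∀ LW : Submodule ℤ V, (LW : Set V) = watsonSet m B L → mapLat σ LW = LW) ∧
    -- (2)
    (∀ LW : Submodule ℤ V, (LW : Set V) = watsonSet m B L →
      -- `Λ_m` maps the genus of `L` into the genus of `Λ_m(L)` ...
      (∀ T : Submodule ℤ V, InGenusSub B L T →
        ∀ TW : Submodule ℤ V, (TW : Set V) = watsonSet m B T → InGenusSub B LW TW) ∧
      -- ... the induced map descends to isometry classes ...
      (∀ T T' : Submodule ℤ V, InGenusSub B L T → InGenusSub B L T' → LatIsomSub B T T' →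
        ∀ TW TW' : Submodule ℤ V, (TW : Set V) = watsonSet m B T →
          (TW' : Set V) = watsonSet m B T' → LatIsomSub B TW TW') ∧
      -- ... and it is surjective onto `gen(Λ_m(L))/∼`.
      (∀ Nl : Submodule ℤ V, InGenusSub B LW Nl →
        ∃ T : Submodule ℤ V, InGenusSub B L T ∧
          ∀ TW : Submodule ℤ V, (TW : Set V) = watsonSet m B T → LatIsomSub B TW Nl)) := by
  obtain ⟨q, e, hq, he, hme⟩ : ∃ q e : ℕ, q.Prime ∧ e ≠ 0 ∧ m = q ^ e := by
    rcases hm with hm | hm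
    · exact ⟨m, 1, hm, one_ne_zero, (pow_one m).symm⟩
    · exact ⟨2, 2, Nat.prime_two, two_ne_zero, by rw [hm]; norm_num⟩
  refine ⟨fun σ hσ => watson_map m L σ hσ,
    fun σ hσ h LW hLW => mapLat_watson m L L LW LW σ hσ h hLW hLW, fun LW hLW => ⟨?_, ?_, ?_⟩⟩
  · intro T hT TW hTW
    exact part_a hsymm hq hme hL hLW hT hTW
  · rintro T T' _ _ ⟨σ, hσ, h⟩ TW TW' hTW hTW'
    exact ⟨σ, hσ, mapLat_watson m T T' TW TW' σ hσ h hTW hTW'⟩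
  · intro Nl hN
    obtain ⟨T, hT, hTN⟩ := part_c hsymm hq hme he hL hLW hN
    refine ⟨T, hT, fun TW hTW => ?_⟩
    have h1 : TW = Nl := SetLike.coe_injective (hTW.trans hTN)
    subst h1
    refine ⟨LinearEquiv.refl ℚ V, fun x y => rfl, ?_⟩
    apply SetLike.coe_injective
    simp [mapLat]
end
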